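/- Let H be a nearest-neighbor one-dimensional SFT presented by a finite directed graph G = (A, E) in which every vertex has at least one outgoing and one incoming edge. Then the following are equivalent: (i) for every one-dimensional SFT V ⊆ A^ℤ, the combined subshift X_{H,V} is either empty or contains a periodic configuration; (ii) G satisfies condition D. -/

import Mathlib

open Filter

/-- Shift on one-dimensional configurations: `(shift1 p x) k = x (k - p)`. -/
def shift1 {A : Type*} (p : ℤ) (x : ℤ → A) : ℤ → A := fun k => x (k - p)

/-- Shift on two-dimensional configurations: `(shift2 v x) k = x (k - v)`. -/
def shift2 {A : Type*} (v : ℤ × ℤ) (x : ℤ × ℤ → A) : ℤ × ℤ → A := fun k => x (k - v)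

/-- The finite word `w` occurs in the bi-infinite sequence `x`. -/
def occursIn1 {A : Type*} (w : List A) (x : ℤ → A) : Prop :=
  ∃ i : ℤ, ∀ (n : ℕ) (h : n < w.length), x (i + n) = w.get ⟨n, h⟩

/-- The one-dimensional SFT avoiding the finite set `F` of forbidden words. -/
def SFT1 {A : Type*} (F : Finset (List A)) : Set (ℤ → A) :=
  {x | ∀ w ∈ F, ¬ occursIn1 w x}

/-- `H` is a one-dimensional subshift of finite type. -/
def IsSFT1 {A : Type*} (H : Set (ℤ → A)) : Prop :=
  ∃ F : Finset (List A), H = SFT1 F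

/-- A finite two-dimensional pattern: a finite support together with values. -/
structure Pattern2 (A : Type*) where
  support : Finset (ℤ × ℤ)
  val : ℤ × ℤ → A

/-- The pattern `p` occurs in the configuration `x`. -/
def Pattern2.OccursIn {A : Type*} (p : Pattern2 A) (x : ℤ × ℤ → A) : Prop :=
  ∃ v : ℤ × ℤ, ∀ u ∈ p.support, x (u + v) = p.val u

/-- The two-dimensional SFT avoiding the finite set `F` of forbidden patterns. -/
def SFT2 {A : Type*} (F : Finset (Pattern2 A)) : Set (ℤ × ℤ → A) :=
  {x | ∀ p ∈ F, ¬ p.OccursIn x}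

/-- The SFT `X_F` with added horizontal constraints from `H`: every row lies in `H`
and no pattern of `F` occurs. -/
def XHF {A : Type*} (H : Set (ℤ → A)) (F : Finset (Pattern2 A)) : Set (ℤ × ℤ → A) :=
  {x | (∀ j : ℤ, (fun k => x (k, j)) ∈ H) ∧ ∀ p ∈ F, ¬ p.OccursIn x}

/-- The combined subshift: rows in `H`, columns in `V`. -/
def XHV {A : Type*} (H V : Set (ℤ → A)) : Set (ℤ × ℤ → A) :=
  {x | (∀ j : ℤ, (fun k => x (k, j)) ∈ H) ∧ ∀ i : ℤ, (fun l => x (i, l)) ∈ V}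

/-- Number of restrictions of elements of `X` to `[0,m) × [0,n)`. -/
noncomputable def patCount2 {A : Type*} (X : Set (ℤ × ℤ → A)) (m n : ℕ) : ℕ :=
  Set.ncard {p : Fin m → Fin n → A |
    ∃ x ∈ X, ∀ (i : Fin m) (j : Fin n), x ((i : ℤ), (j : ℤ)) = p i j}

/-- Topological entropy of a two-dimensional subshift. -/
noncomputable def entropy2 {A : Type*} (X : Set (ℤ × ℤ → A)) : ℝ :=
  ⨅ n : ℕ, Real.logb 2 (patCount2 X (n + 1) (n + 1)) / ((n : ℝ) + 1) ^ 2

/-- The word `w` belongs to the language of `H`. -/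
def wordIn {A : Type*} (H : Set (ℤ → A)) (w : List A) : Prop :=
  ∃ x ∈ H, occursIn1 w x

/-- Number of length-`n` words in the language of `H`. -/
noncomputable def wordCount {A : Type*} (H : Set (ℤ → A)) (n : ℕ) : ℕ :=
  Set.ncard {w : List A | w.length = n ∧ wordIn H w}

/-- Topological entropy of a one-dimensional subshift. -/
noncomputable def entropy1 {A : Type*} (H : Set (ℤ → A)) : ℝ :=
  ⨅ n : ℕ, Real.logb 2 (wordCount H (n + 1)) / ((n : ℝ) + 1)

/-- `X` is a two-dimensional subshift (closed and shift-invariant). -/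
def IsSubshift2 {A : Type*} [TopologicalSpace A] (X : Set (ℤ × ℤ → A)) : Prop :=
  IsClosed X ∧ ∀ (v : ℤ × ℤ) (x : ℤ × ℤ → A), x ∈ X → shift2 v x ∈ X

/-- `X` is an `(m,n)`-th root of `Y`. -/
def IsRoot {A B : Type*} [TopologicalSpace A] [TopologicalSpace B]
    (X : Set (ℤ × ℤ → A)) (Y : Set (ℤ × ℤ → B)) (m n : ℕ) : Prop :=
  ∃ Z : Set (ℤ × ℤ → A), Z ⊆ X ∧ IsClopen {x : X | (x : ℤ × ℤ → A) ∈ Z} ∧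
    shift2 ((m : ℤ), 0) '' Z = Z ∧ shift2 (0, (n : ℤ)) '' Z = Z ∧
    (∃ φ : Z ≃ₜ Y,
      ∀ (x : Z) (k₁ k₂ : ℤ)
        (hx : shift2 (k₁ * (m : ℤ), k₂ * (n : ℤ)) (x : ℤ × ℤ → A) ∈ Z),
        (φ ⟨shift2 (k₁ * (m : ℤ), k₂ * (n : ℤ)) (x : ℤ × ℤ → A), hx⟩ : ℤ × ℤ → B) =
          shift2 (k₁, k₂) (φ x : ℤ × ℤ → B)) ∧
    (∀ i j : ℕ, i < m → j < n → shift2 ((i : ℤ), (j : ℤ)) '' Z ⊆ X) ∧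
    ∀ x ∈ X, ∃! q : Fin m × Fin n, x ∈ shift2 ((q.1 : ℤ), (q.2 : ℤ)) '' Z

/-- The vertex shift (nearest-neighbor SFT) of a directed graph on `A`. -/
def vertexShift {A : Type*} (E : A → A → Prop) : Set (ℤ → A) :=
  {x | ∀ i : ℤ, E (x i) (x (i + 1))}

/-- Strongly connected component: a maximal nonempty set whose vertices are pairwise
joined by nonempty directed paths. -/
def IsSCC {A : Type*} (E : A → A → Prop) (S : Set A) : Prop :=
  S.Nonempty ∧ (∀ a ∈ S, ∀ b ∈ S, Relation.TransGen E a b) ∧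
    ∀ T : Set A, S ⊆ T → (∀ a ∈ T, ∀ b ∈ T, Relation.TransGen E a b) → T = S

def ReflexiveType {A : Type*} (E : A → A → Prop) (S : Set A) : Prop :=
  ∀ v ∈ S, E v v

def SymmetricType {A : Type*} (E : A → A → Prop) (S : Set A) : Prop :=
  ∀ v ∈ S, ∀ w ∈ S, v ≠ w → E v w → E w v

def StateSplitType {A : Type*} (E : A → A → Prop) (S : Set A) : Prop :=
  ∃ p : ℕ, 0 < p ∧ ∃ f : A → ZMod p,
    (∀ i : ZMod p, ∃ v ∈ S, f v = i) ∧
    ∀ v ∈ S, ∀ w ∈ S, (E v w ↔ f w = f v + 1)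

/-- Condition D: all SCCs share one of the three types. -/
def ConditionD {A : Type*} (E : A → A → Prop) : Prop :=
  (∀ S : Set A, IsSCC E S → ReflexiveType E S) ∨
  (∀ S : Set A, IsSCC E S → SymmetricType E S) ∨
  (∀ S : Set A, IsSCC E S → StateSplitType E S)

/-- A real is Π₁-computable (right-recursively enumerable). -/
def Pi1Computable (x : ℝ) : Prop :=
  ∃ f : ℕ → ℚ, Computable f ∧ Antitone f ∧
    Tendsto (fun n => (f n : ℝ)) atTop (nhds x)

/-- A computable real number. -/
def IsComputableReal (x : ℝ) : Prop :=
  ∃ f : ℕ → ℚ, Computable f ∧ ∀ n : ℕ, |(f n : ℝ) - x| ≤ (2 : ℝ) ^ (-(n : ℤ))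

/-- `w` is a finite concatenation of copies of `w₁` and `w₂`. -/
def IsConcat {A : Type*} (w₁ w₂ w : List A) : Prop :=
  ∃ L : List (List A), (∀ v ∈ L, v = w₁ ∨ v = w₂) ∧ w = L.flatten

/-- Transitivity of a one-dimensional subshift. -/
def Transitive1 {A : Type*} (H : Set (ℤ → A)) : Prop :=
  ∀ u w : List A, wordIn H u → wordIn H w → ∃ v : List A, wordIn H (u ++ v ++ w)

/-- The subshift of elements of `H` avoiding the word `u`. -/
def avoidWord {A : Type*} (H : Set (ℤ → A)) (u : List A) : Set (ℤ → A) :=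
  {x ∈ H | ¬ occursIn1 u x}

/-- A transducer tile: the multiplier is `2` or `2/3`, followed by the bottom digit, the top digit,
the incoming carry and the outgoing carry. -/
abbrev MulTile := Bool × Fin 3 × Fin 3 × Fin 4 × Fin 4

namespace MulTile

/-- The denominator of the multiplier `2 / den`. -/
def den (t : MulTile) : ℤ := if t.1 then 1 else 3

/-- The bottom digit. -/
def bot (t : MulTile) : ℤ := (t.2.1 : ℕ)

/-- The top digit. -/
def top (t : MulTile) : ℤ := (t.2.2.1 : ℕ)

/-- The incoming carry. -/
def carryIn (t : MulTile) : ℤ := (t.2.2.2.1 : ℕ)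

/-- The outgoing carry. -/
def carryOut (t : MulTile) : ℤ := (t.2.2.2.2 : ℕ)

/-- The tile performs one step of a multiplication, with nonzero digit on the larger side. -/
def Valid (t : MulTile) : Prop :=
  2 * t.bot + t.carryIn = t.den * t.top + t.carryOut ∧
    (t.den = 3 → 1 ≤ t.bot) ∧ (t.den = 1 → 1 ≤ t.top)

/-- Horizontal matching. -/
def HMatch (t t' : MulTile) : Prop :=
  t.Valid ∧ t.den = t'.den ∧ t.carryOut = t'.carryIn

/-- Vertical matching. -/
def VMatch (t t' : MulTile) : Prop := t.top = t'.bot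

lemma den_eq (t : MulTile) : t.den = 1 ∨ t.den = 3 := by
  unfold den; split <;> simp

lemma bot_bounds (t : MulTile) : 0 ≤ t.bot ∧ t.bot ≤ 2 := by
  unfold bot; omega

lemma carryIn_bounds (t : MulTile) : 0 ≤ t.carryIn ∧ t.carryIn ≤ 3 := by
  unfold carryIn; omega

lemma exists_tile (d a b c c' : ℤ) (hd : d = 1 ∨ d = 3) (ha : 0 ≤ a ∧ a ≤ 2)
    (hb : 0 ≤ b ∧ b ≤ 2) (hc : 0 ≤ c ∧ c ≤ 3) (hc' : 0 ≤ c' ∧ c' ≤ 3) :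
    ∃ t : MulTile, t.den = d ∧ t.bot = a ∧ t.top = b ∧ t.carryIn = c ∧ t.carryOut = c' := by
  refine ⟨(decide (d = 1), ⟨a.toNat, by omega⟩, ⟨b.toNat, by omega⟩, ⟨c.toNat, by omega⟩,
    ⟨c'.toNat, by omega⟩), ?_, ?_, ?_, ?_, ?_⟩
  · rcases hd with rfl | rfl <;> simp [den]
  all_goals simp [bot, top, carryIn, carryOut]; omega

lemma exists_orbit : ∃ x : ℤ → ℚ, ∀ j, 2 / 3 < x j ∧ x j ≤ 2 ∧
    x (j + 1) = 2 * x j / (if x j ≤ 1 then 1 else 3) := by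
  let f : Set.Ioc (2 / 3 : ℚ) 2 → Set.Ioc (2 / 3 : ℚ) 2 := fun x =>
    ⟨2 * x.1 / (if x.1 ≤ 1 then 1 else 3), by
      obtain ⟨x, h1, h2⟩ := x
      split <;> constructor <;> simp at * <;> linarith⟩
  have hf : Function.Bijective f := by
    constructor
    · rintro ⟨x, h1, h2⟩ ⟨y, h3, h4⟩ h
      have h' : 2 * x / (if x ≤ 1 then 1 else 3) = 2 * y / (if y ≤ 1 then 1 else 3) :=
        congrArg Subtype.val h
      apply Subtype.ext
      show x = y
      split_ifs at h' <;> linarith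
    · rintro ⟨y, h1, h2⟩
      by_cases hy : y ≤ 4 / 3
      · refine ⟨⟨3 * y / 2, by linarith, by linarith⟩, Subtype.ext ?_⟩
        show 2 * (3 * y / 2) / (if 3 * y / 2 ≤ 1 then 1 else 3) = y
        rw [if_neg (by linarith)]; ring
      · refine ⟨⟨y / 2, by linarith, by linarith⟩, Subtype.ext ?_⟩
        show 2 * (y / 2) / (if y / 2 ≤ 1 then 1 else 3) = y
        rw [if_pos (by linarith)]; ring
  let e : Equiv.Perm (Set.Ioc (2 / 3 : ℚ) 2) := Equiv.ofBijective f hf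
  have h1 : (1 : ℚ) ∈ Set.Ioc (2 / 3 : ℚ) 2 := by constructor <;> norm_num
  refine ⟨fun j => ((e ^ j) ⟨1, h1⟩).1, fun j =>
    ⟨((e ^ j) ⟨1, h1⟩).2.1, ((e ^ j) ⟨1, h1⟩).2.2, ?_⟩⟩
  have h2 : (e ^ (j + 1)) ⟨1, h1⟩ = f ((e ^ j) ⟨1, h1⟩) := by
    rw [add_comm j 1, zpow_add, zpow_one, Equiv.Perm.mul_apply]
    rfl
  exact congrArg Subtype.val h2

lemma exists_tiling : ∃ τ : ℤ → ℤ → MulTile,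
    (∀ k j, HMatch (τ k j) (τ (k + 1) j)) ∧ ∀ k j, VMatch (τ k j) (τ k (j + 1)) := by
  obtain ⟨x, hx⟩ := exists_orbit
  let d : ℤ → ℤ := fun j => if x j ≤ 1 then 1 else 3
  let a : ℤ → ℤ → ℤ := fun k j => ⌊((k + 1 : ℤ) : ℚ) * x j⌋ - ⌊(k : ℚ) * x j⌋
  let c : ℤ → ℤ → ℤ := fun k j => 2 * ⌊(k : ℚ) * x j⌋ - d j * ⌊(k : ℚ) * x (j + 1)⌋ + 1
  have hd : ∀ j, d j = 1 ∨ d j = 3 := fun j => by dsimp only [d]; split <;> simp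
  have hdx : ∀ j, (d j : ℚ) * x (j + 1) = 2 * x j := fun j => by
    rw [(hx j).2.2]; dsimp only [d]; split <;> push_cast <;> ring
  have hlow : ∀ (k j n : ℤ), (n : ℚ) ≤ x j → n ≤ a k j := fun k j n h => by
    have h1 := Int.floor_le ((k : ℚ) * x j)
    have : ⌊(k : ℚ) * x j⌋ + n ≤ ⌊((k + 1 : ℤ) : ℚ) * x j⌋ := by
      rw [Int.le_floor]; push_cast; linarith
    dsimp only [a]; linarith
  have ha : ∀ k j, 0 ≤ a k j ∧ a k j ≤ 2 := fun k j => by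
    refine ⟨hlow k j 0 (by have := (hx j).1; push_cast; linarith), ?_⟩
    have h1 := Int.lt_floor_add_one ((k : ℚ) * x j)
    have h2 := (hx j).2.1
    have : ⌊((k + 1 : ℤ) : ℚ) * x j⌋ < ⌊(k : ℚ) * x j⌋ + 3 := by
      rw [Int.floor_lt]; push_cast; linarith
    dsimp only [a]; linarith
  have hc : ∀ k j, 0 ≤ c k j ∧ c k j ≤ 3 := fun k j => by
    have h1 := Int.floor_le ((k : ℚ) * x j)
    have h2 := Int.lt_floor_add_one ((k : ℚ) * x j)
    have h3 := Int.floor_le ((k : ℚ) * x (j + 1))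
    have h4 := Int.lt_floor_add_one ((k : ℚ) * x (j + 1))
    have h5 : (d j : ℚ) * (k * x (j + 1)) = 2 * (k * x j) := by
      rw [mul_left_comm, hdx]; ring
    dsimp only [c]
    generalize ⌊(k : ℚ) * x j⌋ = u at *
    generalize ⌊(k : ℚ) * x (j + 1)⌋ = w at *
    have hlt : (-2 : ℚ) < ((2 * u - d j * w : ℤ) : ℚ) := by
      push_cast
      rcases hd j with h | h <;> rw [h] at h5 ⊢ <;> push_cast at * <;> linarith
    have hgt : ((2 * u - d j * w : ℤ) : ℚ) < 3 := by
      push_cast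
      rcases hd j with h | h <;> rw [h] at h5 ⊢ <;> push_cast at * <;> linarith
    have hlt' : -2 < 2 * u - d j * w := by exact_mod_cast hlt
    have hgt' : 2 * u - d j * w < 3 := by exact_mod_cast hgt
    constructor <;> linarith
  choose τ h1 h2 h3 h4 h5 using fun k j => exists_tile (d j) (a k j) (a k (j + 1)) (c k j)
    (c (k + 1) j) (hd j) (ha k j) (ha k (j + 1)) (hc k j) (hc (k + 1) j)
  refine ⟨τ, fun k j => ⟨⟨?_, ?_, ?_⟩, ?_, ?_⟩, fun k j => ?_⟩
  · rw [h1, h2, h3, h4, h5]; dsimp only [a, c]; ring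
  · rw [h1, h2]; intro h
    refine hlow k j 1 ?_
    dsimp only [d] at h
    split_ifs at h with h'
    · exact absurd h (by norm_num)
    · push_cast; linarith
  · rw [h1, h3]; intro h
    refine hlow k (j + 1) 1 ?_
    have := hdx j
    rw [h] at this
    have := (hx j).1
    push_cast at *; linarith
  · rw [h1, h1]
  · rw [h4, h5]
  · rw [VMatch, h2, h3]

section Aperiodic

variable {τ : ℤ → ℤ → MulTile}

/-- Sum of the first `n` bottom digits of row `j`. -/
def rowSum (τ : ℤ → ℤ → MulTile) (n : ℕ) (j : ℤ) : ℤ :=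
  ∑ k ∈ Finset.range n, (τ k j).bot

lemma den_const (hH : ∀ k j, HMatch (τ k j) (τ (k + 1) j)) (k j : ℤ) :
    (τ k j).den = (τ 0 j).den := by
  induction k using Int.induction_on with
  | zero => rfl
  | succ i ih => rw [← (hH i j).2.1, ih]
  | pred i ih => rw [(hH (-i - 1) j).2.1, sub_add_cancel, ih]

lemma two_mul_rowSum (hH : ∀ k j, HMatch (τ k j) (τ (k + 1) j))
    (hV : ∀ k j, VMatch (τ k j) (τ k (j + 1))) (n : ℕ) (j : ℤ) :
    2 * rowSum τ n j + (τ 0 j).carryIn =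
      (τ 0 j).den * rowSum τ n (j + 1) + (τ n j).carryIn := by
  induction n with
  | zero => simp [rowSum]
  | succ n ih =>
    have h1 := (hH n j).1.1
    have h2 := (hH n j).2.2
    have h3 : (τ n j).top = _ := hV n j
    rw [den_const hH, h3, h2] at h1
    simp only [rowSum, Finset.sum_range_succ] at *
    push_cast
    linarith

lemma rowSum_lower (hH : ∀ k j, HMatch (τ k j) (τ (k + 1) j))
    (hV : ∀ k j, VMatch (τ k j) (τ k (j + 1))) (n : ℕ) (j : ℤ) :
    (n : ℤ) ≤ 2 * rowSum τ n j + 3 := by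
  have hc := (τ 0 j).carryIn_bounds
  have hc' := (τ n j).carryIn_bounds
  rcases (τ 0 j).den_eq with h | h
  · have hs : (n : ℤ) ≤ rowSum τ n (j + 1) := by
      have : ∑ k ∈ Finset.range n, (1 : ℤ) ≤ rowSum τ n (j + 1) := by
        refine Finset.sum_le_sum fun k _ => ?_
        rw [← show (τ k j).top = _ from hV k j]
        exact (hH k j).1.2.2 (by rw [den_const hH, h])
      simpa using this
    have := two_mul_rowSum hH hV n j
    rw [h] at this
    linarith
  · have hs : (n : ℤ) ≤ rowSum τ n j := by
      have : ∑ k ∈ Finset.range n, (1 : ℤ) ≤ rowSum τ n j :=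
        Finset.sum_le_sum fun k _ => (hH k j).1.2.1 (by rw [den_const hH, h])
      simpa using this
    linarith

lemma rowSum_pos_period (hH : ∀ k j, HMatch (τ k j) (τ (k + 1) j))
    (hV : ∀ k j, VMatch (τ k j) (τ k (j + 1))) {p : ℕ} (hp : 0 < p)
    (hper : ∀ k j, τ (k + p) j = τ k j) (j : ℤ) : 0 < rowSum τ p j := by
  have hc : (τ p j).carryIn = (τ 0 j).carryIn := by rw [← hper 0 j, zero_add]
  have h2 := two_mul_rowSum hH hV p j
  rw [hc] at h2
  rcases (τ 0 j).den_eq with h | h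
  · have hs : (p : ℤ) ≤ rowSum τ p (j + 1) := by
      have : ∑ k ∈ Finset.range p, (1 : ℤ) ≤ rowSum τ p (j + 1) := by
        refine Finset.sum_le_sum fun k _ => ?_
        rw [← show (τ k j).top = _ from hV k j]
        exact (hH k j).1.2.2 (by rw [den_const hH, h])
      simpa using this
    rw [h] at h2
    omega
  · have hs : (p : ℤ) ≤ rowSum τ p j := by
      have : ∑ k ∈ Finset.range p, (1 : ℤ) ≤ rowSum τ p j :=
        Finset.sum_le_sum fun k _ => (hH k j).1.2.1 (by rw [den_const hH, h])
      simpa using this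
    omega

lemma no_horizontal_period (hH : ∀ k j, HMatch (τ k j) (τ (k + 1) j))
    (hV : ∀ k j, VMatch (τ k j) (τ k (j + 1))) {p : ℕ} (hp : 0 < p)
    (hper : ∀ k j, τ (k + p) j = τ k j) : False := by
  have hdvd : ∀ (m : ℕ) (j : ℤ), (2 : ℤ) ^ m ∣ rowSum τ p (j + m) := by
    intro m
    induction m with
    | zero => simp
    | succ m ih =>
      intro j
      have hc : (τ p (j + m)).carryIn = (τ 0 (j + m)).carryIn := by
        rw [← hper 0 (j + m), zero_add]
      have h := two_mul_rowSum hH hV p (j + m)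
      rw [hc, add_left_inj] at h
      have hd : (2 : ℤ) ^ (m + 1) ∣ (τ 0 (j + m)).den * rowSum τ p (j + m + 1) := by
        rw [← h, pow_succ']
        exact mul_dvd_mul_left 2 (ih j)
      have hco : IsCoprime ((2 : ℤ) ^ (m + 1)) (τ 0 (j + m)).den := by
        apply IsCoprime.pow_left
        rcases (τ 0 (j + m)).den_eq with h | h <;> rw [h]
        · exact isCoprime_one_right
        · exact ⟨-1, 1, by norm_num⟩
      rw [Nat.cast_succ, ← add_assoc]
      exact hco.dvd_of_dvd_mul_left hd
  have hup : rowSum τ p (0 + (2 * p : ℕ)) ≤ 2 * p := by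
    have : rowSum τ p (0 + (2 * p : ℕ)) ≤ ∑ k ∈ Finset.range p, (2 : ℤ) :=
      Finset.sum_le_sum fun k _ => (τ k _).bot_bounds.2
    simp at this ⊢
    linarith
  have h1 := Int.le_of_dvd (rowSum_pos_period hH hV hp hper _) (hdvd (2 * p) 0)
  have h2 : ((2 * p : ℕ) : ℤ) < 2 ^ (2 * p) := by exact_mod_cast Nat.lt_two_pow_self
  push_cast at *
  linarith

lemma exists_odd_approx (hH : ∀ k j, HMatch (τ k j) (τ (k + 1) j))
    (hV : ∀ k j, VMatch (τ k j) (τ k (j + 1))) (m : ℕ) :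
    ∃ Q C : ℤ, Odd Q ∧ ∀ n : ℕ, |2 ^ m * rowSum τ n 0 - Q * rowSum τ n m| ≤ C := by
  induction m with
  | zero => exact ⟨1, 0, odd_one, fun n => by simp⟩
  | succ m ih =>
    obtain ⟨Q, C, hQ, h⟩ := ih
    refine ⟨Q * (τ 0 m).den, 2 * C + |Q| * 3, hQ.mul ?_, fun n => ?_⟩
    · rcases (τ 0 m).den_eq with h | h <;> rw [h] <;> decide
    · have h1 := two_mul_rowSum hH hV n m
      have hc := (τ 0 m).carryIn_bounds
      have hc' := (τ n m).carryIn_bounds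
      have h2 : |(τ n m).carryIn - (τ 0 m).carryIn| ≤ 3 := by rw [abs_le]; omega
      have h3 : 2 ^ (m + 1) * rowSum τ n 0 - Q * (τ 0 m).den * rowSum τ n ((m + 1 : ℕ) : ℤ) =
          2 * (2 ^ m * rowSum τ n 0 - Q * rowSum τ n m) +
            Q * ((τ n m).carryIn - (τ 0 m).carryIn) := by
        push_cast
        linear_combination Q * h1
      rw [h3]
      refine (abs_add_le _ _).trans ?_
      rw [abs_mul, abs_mul, abs_two]
      exact add_le_add (mul_le_mul_of_nonneg_left (h n) zero_le_two)
        (mul_le_mul_of_nonneg_left h2 (abs_nonneg Q))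

lemma exists_shift_bound (f : ℤ → ℤ) (hf : ∀ k, 0 ≤ f k ∧ f k ≤ 2) (p : ℤ) : ∃ C, ∀ n : ℕ,
    |∑ k ∈ Finset.range n, f (k + p) - ∑ k ∈ Finset.range n, f k| ≤ C := by
  induction p using Int.induction_on with
  | zero => exact ⟨0, fun n => by simp⟩
  | succ i ih =>
    obtain ⟨C, hC⟩ := ih
    refine ⟨C + 2, fun n => ?_⟩
    have h1 : ∀ n : ℕ, ∑ k ∈ Finset.range n, f (k + (i + 1)) =
        ∑ k ∈ Finset.range n, f (k + i) + f (n + i) - f i := fun n => by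
      induction n with
      | zero => simp
      | succ n ih =>
        rw [Finset.sum_range_succ, ih, Finset.sum_range_succ]
        push_cast
        rw [show (n : ℤ) + (i + 1) = n + 1 + i by ring]
        ring
    have h2 := hC n
    have h3 := hf (n + i)
    have h4 := hf i
    rw [h1 n]
    rw [abs_le] at *
    omega
  | pred i ih =>
    obtain ⟨C, hC⟩ := ih
    refine ⟨C + 2, fun n => ?_⟩
    have h1 : ∀ n : ℕ, ∑ k ∈ Finset.range n, f (k + (-i - 1)) =
        ∑ k ∈ Finset.range n, f (k + -i) - f (n + (-i - 1)) + f (-i - 1) := fun n => by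
      induction n with
      | zero => simp
      | succ n ih =>
        rw [Finset.sum_range_succ, ih, Finset.sum_range_succ]
        push_cast
        rw [show (n : ℤ) + 1 + (-i - 1) = n + -i by ring]
        ring
    have h2 := hC n
    have h3 := hf (n + (-i - 1))
    have h4 := hf (-i - 1)
    rw [h1 n]
    rw [abs_le] at *
    omega

lemma no_vertical_period (hH : ∀ k j, HMatch (τ k j) (τ (k + 1) j))
    (hV : ∀ k j, VMatch (τ k j) (τ k (j + 1))) (p : ℤ) {q : ℕ} (hq : 0 < q)
    (hper : ∀ k j, τ (k + p) (j + q) = τ k j) : False := by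
  obtain ⟨Q, C, hQ, hC⟩ := exists_odd_approx hH hV q
  obtain ⟨C', hC'⟩ := exists_shift_bound (fun k => (τ k q).bot) (fun k => (τ k q).bot_bounds) p
  have hC'' : ∀ n, |rowSum τ n 0 - rowSum τ n q| ≤ C' := fun n => by
    have h := hC' n
    simpa only [rowSum, ← hper _ 0, zero_add] using h
  have hne : (2 : ℤ) ^ q - Q ≠ 0 := by
    intro h
    rw [← sub_eq_zero.1 h] at hQ
    exact Int.not_even_iff_odd.2 hQ ((even_two).pow_of_ne_zero hq.ne')
  have key : ∀ n, |rowSum τ n 0| ≤ C + |Q| * C' := fun n => by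
    have h1 : (2 ^ q - Q) * rowSum τ n 0 = (2 ^ q * rowSum τ n 0 - Q * rowSum τ n q) -
        Q * (rowSum τ n 0 - rowSum τ n q) := by ring
    have h2 : |rowSum τ n 0| ≤ |(2 ^ q - Q) * rowSum τ n 0| := by
      rw [abs_mul]
      exact le_mul_of_one_le_left (abs_nonneg _) (Int.one_le_abs hne)
    refine h2.trans ?_
    rw [h1]
    refine (abs_sub _ _).trans ?_
    rw [abs_mul]
    exact add_le_add (hC n) (mul_le_mul_of_nonneg_left (hC'' n) (abs_nonneg Q))
  have h3 := rowSum_lower hH hV (2 * (C + |Q| * C') + 4).toNat 0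
  have h4 := (abs_le.1 (key (2 * (C + |Q| * C') + 4).toNat)).2
  have h5 := Int.self_le_toNat (2 * (C + |Q| * C') + 4)
  linarith

lemma aperiodic (hH : ∀ k j, HMatch (τ k j) (τ (k + 1) j))
    (hV : ∀ k j, VMatch (τ k j) (τ k (j + 1))) (p q : ℤ)
    (hper : ∀ k j, τ (k + p) (j + q) = τ k j) : p = 0 ∧ q = 0 := by
  have hneg : ∀ k j, τ (k + -p) (j + -q) = τ k j := fun k j => by
    rw [← hper (k + -p)]; simp
  have hq0 : q = 0 := by
    rcases lt_trichotomy q 0 with hq | hq | hq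
    · refine (no_vertical_period hH hV (-p) (q := (-q).toNat) (by omega) ?_).elim
      rwa [Int.toNat_of_nonneg (by omega)]
    · exact hq
    · refine (no_vertical_period hH hV p (q := q.toNat) (by omega) ?_).elim
      rwa [Int.toNat_of_nonneg (by omega)]
  subst hq0
  simp only [neg_zero, add_zero] at *
  refine ⟨?_, trivial⟩
  rcases lt_trichotomy p 0 with hp | hp | hp
  · refine (no_horizontal_period hH hV (p := (-p).toNat) (by omega) ?_).elim
    rwa [Int.toNat_of_nonneg (by omega)]
  · exact hp
  · refine (no_horizontal_period hH hV (p := p.toNat) (by omega) ?_).elim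
    rwa [Int.toNat_of_nonneg (by omega)]

end Aperiodic

end MulTile

section Walks

variable {A : Type*} {E : A → A → Prop}

/-- `Steps E n a b`: there is a walk of length `n` from `a` to `b`. -/
def Steps (E : A → A → Prop) : ℕ → A → A → Prop
  | 0, a, b => a = b
  | n + 1, a, b => ∃ c, Steps E n a c ∧ E c b

lemma steps_add {m n : ℕ} {a b : A} :
    Steps E (m + n) a b ↔ ∃ c, Steps E m a c ∧ Steps E n c b := by
  induction n generalizing b with
  | zero => simp [Steps]
  | succ n ih =>
    rw [← add_assoc]
    simp only [Steps, ih]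
    constructor
    · rintro ⟨c, ⟨d, h1, h2⟩, h3⟩
      exact ⟨d, h1, c, h2, h3⟩
    · rintro ⟨d, h1, c, h2, h3⟩
      exact ⟨c, ⟨d, h1, h2⟩, h3⟩

lemma Steps.trans {m n : ℕ} {a b c : A} (h : Steps E m a b) (h' : Steps E n b c) :
    Steps E (m + n) a c := steps_add.2 ⟨b, h, h'⟩

lemma steps_one {a b : A} : Steps E 1 a b ↔ E a b := by simp [Steps]

lemma Steps.mul_self {k : ℕ} {a : A} (h : Steps E k a a) (n : ℕ) : Steps E (k * n) a a := by
  induction n with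
  | zero => rfl
  | succ n ih => exact ih.trans h

lemma transGen_of_steps {n : ℕ} (hn : 0 < n) {a b : A} (h : Steps E n a b) :
    Relation.TransGen E a b := by
  induction n generalizing b with
  | zero => exact absurd hn (lt_irrefl 0)
  | succ n ih =>
    obtain ⟨c, h1, h2⟩ := h
    rcases n.eq_zero_or_pos with rfl | hn'
    · rw [show a = c from h1]
      exact .single h2
    · exact (ih hn' h1).tail h2

lemma exists_steps_of_transGen {a b : A} (h : Relation.TransGen E a b) :
    ∃ n, 0 < n ∧ Steps E n a b := by
  induction h with
  | single h => exact ⟨1, one_pos, steps_one.2 h⟩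
  | tail _ h ih =>
    obtain ⟨n, _, hn⟩ := ih
    exact ⟨n + 1, n.succ_pos, _, hn, h⟩

/-- The powers of `E` are periodic with period `L` from `L` on. -/
def StabilizesAt (E : A → A → Prop) (L : ℕ) : Prop :=
  0 < L ∧ ∀ k, L ≤ k → Steps E (k + L) = Steps E k

lemma exists_stabilizesAt [Finite A] (E : A → A → Prop) : ∃ L, StabilizesAt E L := by
  obtain ⟨m, n, hne, h⟩ := Finite.exists_ne_map_eq_of_infinite (Steps E)
  wlog hmn : m < n generalizing m n
  · exact this n m hne.symm h.symm (by omega)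
  have h1 : ∀ k, m ≤ k → Steps E (k + (n - m)) = Steps E k := fun k hk => by
    obtain ⟨l, rfl⟩ := Nat.exists_eq_add_of_le hk
    rw [show m + l + (n - m) = n + l by omega]
    ext a b
    rw [steps_add, steps_add, h]
  have h2 : ∀ t k, m ≤ k → Steps E (k + (n - m) * t) = Steps E k := fun t => by
    induction t with
    | zero => simp
    | succ t ih => exact fun k hk => by rw [mul_add_one, ← add_assoc, h1 _ (by omega), ih k hk]
  refine ⟨(n - m) * (m + 1), Nat.mul_pos (by omega) m.succ_pos, fun k hk => h2 _ k ?_⟩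
  have : 1 * (m + 1) ≤ (n - m) * (m + 1) := Nat.mul_le_mul_right _ (by omega)
  omega

lemma StabilizesAt.steps_eq {L : ℕ} (hL : StabilizesAt E L) {k k' : ℕ} (hk : L ≤ k)
    (hk' : L ≤ k') (h : k ≡ k' [MOD L]) : Steps E k = Steps E k' := by
  have h1 : ∀ t k, L ≤ k → Steps E (k + L * t) = Steps E k := fun t => by
    induction t with
    | zero => simp
    | succ t ih => exact fun k hk => by rw [mul_add_one, ← add_assoc, hL.2 _ (by omega), ih k hk]
  wlog hle : k ≤ k' generalizing k k'
  · exact (this hk' hk h.symm (by omega)).symm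
  obtain ⟨t, ht⟩ := (Nat.modEq_iff_dvd' hle).1 h
  rw [show k' = k + L * t by omega, h1 t k hk]

lemma StabilizesAt.return {L : ℕ} (hL : StabilizesAt E L) {e n : ℕ} {u v : A}
    (h : Steps E e u v) (h' : Relation.TransGen E v u) (hn : L ≤ n) (hne : L ∣ n + e) :
    Steps E n v u := by
  obtain ⟨k, hk, hvu⟩ := exists_steps_of_transGen h'
  have h1 : Steps E (k + (e + k) * (2 * L - 1)) v u := hvu.trans ((h.trans hvu).mul_self _)
  have h0 := hL.1
  have h2 : k + (e + k) * (2 * L - 1) + e = L * (2 * (e + k)) := by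
    obtain ⟨l, rfl⟩ := Nat.exists_eq_add_of_lt h0
    rw [show 2 * (0 + l + 1) - 1 = 2 * l + 1 by omega]
    ring
  rw [hL.steps_eq hn _ _]
  · exact h1
  · have : L * 1 + 1 * (e + k) ≤ L * (e + k) + L * (e + k) :=
      add_le_add (Nat.mul_le_mul_left _ (by omega)) (Nat.mul_le_mul_right _ h0)
    have : L * (2 * (e + k)) = L * (e + k) + L * (e + k) := by ring
    omega
  · refine Nat.ModEq.add_right_cancel' e ?_
    rw [h2]
    exact ((Nat.modEq_zero_iff_dvd.2 hne)).trans
      (Nat.modEq_zero_iff_dvd.2 (dvd_mul_right _ _)).symm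

/-- A closed walk of length `M`, indexed by the residues modulo `M`. -/
def ClosedWalk (E : A → A → Prop) {M : ℕ} (w : ZMod M → A) : Prop :=
  ∀ z, E (w z) (w (z + 1))

lemma exists_path {n : ℕ} {a b : A} (h : Steps E n a b) :
    ∃ f : ℕ → A, f 0 = a ∧ f n = b ∧ ∀ k < n, E (f k) (f (k + 1)) := by
  induction n generalizing b with
  | zero => exact ⟨fun _ => a, rfl, h, by simp⟩
  | succ n ih =>
    obtain ⟨c, h1, h2⟩ := h
    obtain ⟨f, hf0, hfn, hf⟩ := ih h1
    refine ⟨fun k => if k ≤ n then f k else b, by simpa using hf0, by simp, fun k hk => ?_⟩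
    rcases Nat.lt_succ_iff_lt_or_eq.1 hk with hk' | rfl
    · simp only [if_pos hk'.le, if_pos (Nat.succ_le_of_lt hk')]
      exact hf k hk'
    · simpa [hfn] using h2

lemma exists_closedWalk {M : ℕ} [NeZero M] {d e : ℕ} {u v : A} (hM : d + e = M)
    (h : Steps E d u v) (h' : Steps E e v u) (i : ZMod M) :
    ∃ w : ZMod M → A, ClosedWalk E w ∧ w i = u ∧ w (i + d) = v := by
  obtain ⟨f, hf0, hfd, hf⟩ := exists_path h
  obtain ⟨g, hg0, hge, hg⟩ := exists_path h'
  let p : ℕ → A := fun k => if k ≤ d then f k else g (k - d)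
  have hp : ∀ k < M, E (p k) (p (k + 1)) := fun k hk => by
    rcases lt_trichotomy k d with h | h | h
    · simp only [p, if_pos h.le, if_pos (Nat.succ_le_of_lt h)]
      exact hf k h
    · simp only [p, h, le_refl, if_true, add_le_iff_nonpos_right, nonpos_iff_eq_zero,
        one_ne_zero, if_false, add_tsub_cancel_left]
      rw [hfd, ← hg0]
      exact hg 0 (by omega)
    · simp only [p, if_neg (show ¬ k ≤ d by omega), if_neg (show ¬ k + 1 ≤ d by omega)]
      rw [show k + 1 - d = k - d + 1 by omega]
      exact hg (k - d) (by omega)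
  have hp0 : p 0 = u := by simp [p, hf0]
  have hpM : p M = u := by
    rcases e.eq_zero_or_pos with rfl | he
    · simp only [p, ← hM, add_zero, le_refl, if_true, hfd]
      exact h'
    · simp [p, ← hM, hge, he.ne']
  have hpd : p d = v := by simp [p, hfd]
  have hval : ∀ k ≤ M, p (k : ZMod M).val = p k := fun k hk => by
    rcases hk.lt_or_eq with hk | rfl
    · rw [ZMod.val_cast_of_lt hk]
    · simp [hp0, hpM]
  refine ⟨fun z => p (z - i).val, fun z => ?_, ?_, ?_⟩
  · have h1 := hp (z - i).val (ZMod.val_lt _)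
    have h2 := hval ((z - i).val + 1) (ZMod.val_lt (z - i))
    rw [← h2] at h1
    push_cast at h1
    rwa [ZMod.natCast_zmod_val, show z - i + 1 = z + 1 - i by ring] at h1
  · simp [hp0]
  · simp only [add_sub_cancel_left]
    exact (hval d (by omega)).trans hpd

lemma IsSCC.mem_iff {S : Set A} (hS : IsSCC E S) {v x : A} (hv : v ∈ S) :
    x ∈ S ↔ Relation.TransGen E v x ∧ Relation.TransGen E x v := by
  refine ⟨fun hx => ⟨hS.2.1 v hv x hx, hS.2.1 x hx v hv⟩, fun hx => ?_⟩
  have h := hS.2.2 {y | Relation.TransGen E v y ∧ Relation.TransGen E y v}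
    (fun y hy => ⟨hS.2.1 v hv y hy, hS.2.1 y hy v hv⟩)
    (fun a ha b hb => ha.2.trans hb.1)
  rw [← h]
  exact hx

lemma isSCC_of_transGen {v : A} (hv : Relation.TransGen E v v) :
    IsSCC E {y | Relation.TransGen E v y ∧ Relation.TransGen E y v} :=
  ⟨⟨v, hv, hv⟩, fun _ ha _ hb => ha.2.trans hb.1, fun _ hT h =>
    Set.Subset.antisymm (fun y hy => ⟨h v (hT ⟨hv, hv⟩) y hy, h y hy v (hT ⟨hv, hv⟩)⟩) hT⟩

lemma IsSCC.mem_of_steps {S : Set A} (hS : IsSCC E S) {a b c : A} (ha : a ∈ S) (hc : c ∈ S)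
    {m n : ℕ} (h : Steps E m a b) (h' : Steps E n b c) : b ∈ S := by
  rcases m.eq_zero_or_pos with rfl | hm
  · rw [← show a = b from h]; exact ha
  rcases n.eq_zero_or_pos with rfl | hn
  · rw [show b = c from h']; exact hc
  exact (hS.mem_iff ha).2 ⟨transGen_of_steps hm h,
    (transGen_of_steps hn h').trans (hS.2.1 c hc a ha)⟩

lemma IsSCC.exists_steps {S : Set A} (hS : IsSCC E S) {a : A} (ha : a ∈ S) (n : ℕ) :
    ∃ b ∈ S, Steps E n a b := by
  induction n with
  | zero => exact ⟨a, ha, rfl⟩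
  | succ n ih =>
    obtain ⟨b, hb, h⟩ := ih
    obtain ⟨k, hk, h'⟩ := exists_steps_of_transGen (hS.2.1 b hb b hb)
    obtain ⟨c, hc, hc'⟩ := (steps_add (m := 1) (n := k - 1)).1
      (by rwa [show 1 + (k - 1) = k by omega])
    exact ⟨c, hS.mem_of_steps hb hb hc hc', _, h, steps_one.1 hc⟩

lemma IsSCC.stateSplitType_of_steps [Finite A] {S : Set A} (hS : IsSCC E S) {d : ℕ} (hd : 2 ≤ d)
    (h : ∀ u ∈ S, ∀ v ∈ S, Steps E d u v → E u v) : StateSplitType E S := by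
  obtain ⟨L, hL⟩ := exists_stabilizesAt E
  have hL0 := hL.1
  have h1 : ∀ k, ∀ u ∈ S, ∀ v ∈ S, Steps E (1 + k * (d - 1)) u v → E u v := fun k => by
    induction k with
    | zero => exact fun u _ v _ h => steps_one.1 (by simpa using h)
    | succ k ih =>
      intro u hu v hv huv
      rw [show 1 + (k + 1) * (d - 1) = d + k * (d - 1) by rw [add_mul]; omega] at huv
      obtain ⟨x, hux, hxv⟩ := steps_add.1 huv
      exact ih u hu v hv
        ((steps_one.2 (h u hu x (hS.mem_of_steps hu hv hux hxv) hux)).trans hxv)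
  have h2 : ∀ n, L ≤ n → n ≡ 1 [MOD L] → ∀ u ∈ S, ∀ v ∈ S, Steps E n u v → E u v := by
    intro n hn hn1 u hu v hv huv
    refine h1 L u hu v hv ?_
    have h3 : L * 1 ≤ L * (d - 1) := Nat.mul_le_mul_left _ (by omega)
    rwa [hL.steps_eq (k' := n) (by omega) hn _]
    refine Nat.ModEq.trans ?_ hn1.symm
    simp [Nat.ModEq]
  obtain ⟨v₀, hv₀⟩ := hS.1
  let P : Set ℕ := {n | Steps E n v₀ v₀}
  let p := Nat.setGcd P
  obtain ⟨N, hN⟩ := Nat.exists_mem_closure_of_ge P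
  have hP : AddSubmonoid.closure P ≤
      { carrier := P, add_mem' := fun ha hb => Steps.trans ha hb, zero_mem' := rfl } :=
    AddSubmonoid.closure_le.2 fun _ hx => hx
  have hLP : p ∣ L := Nat.setGcd_dvd_of_mem (s := P) <|
    hL.return (u := v₀) (e := 0) rfl (hS.2.1 v₀ hv₀ v₀ hv₀) le_rfl (by simp)
  have hp0 : 0 < p := Nat.pos_of_dvd_of_pos hLP hL0
  have hreach : ∀ v, ∃ n, v ∈ S → Steps E n v₀ v := fun v => by
    by_cases hv : v ∈ S
    · obtain ⟨n, -, hn⟩ := exists_steps_of_transGen (hS.2.1 v₀ hv₀ v hv)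
      exact ⟨n, fun _ => hn⟩
    · exact ⟨0, fun h => absurd h hv⟩
  choose n hn using hreach
  have hcls : ∀ v ∈ S, ∀ m, Steps E m v₀ v → (n v : ZMod p) = m := by
    intro v hv m hm
    obtain ⟨k, -, hk⟩ := exists_steps_of_transGen (hS.2.1 v hv v₀ hv₀)
    have e1 : ((n v + k : ℕ) : ZMod p) = 0 :=
      (ZMod.natCast_eq_zero_iff _ _).2 (Nat.setGcd_dvd_of_mem (s := P) ((hn v hv).trans hk))
    have e2 : ((m + k : ℕ) : ZMod p) = 0 :=
      (ZMod.natCast_eq_zero_iff _ _).2 (Nat.setGcd_dvd_of_mem (s := P) (hm.trans hk))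
    push_cast at e1 e2
    rw [eq_neg_of_add_eq_zero_left e1, eq_neg_of_add_eq_zero_left e2]
  have : NeZero p := ⟨hp0.ne'⟩
  refine ⟨p, hp0, fun v => n v, fun i => ?_, fun v hv w hw => ⟨fun hvw => ?_, fun hvw => ?_⟩⟩
  · obtain ⟨b, hb, hib⟩ := hS.exists_steps hv₀ i.val
    exact ⟨b, hb, by simp [hcls b hb _ hib]⟩
  · simp only [hcls w hw (n v + 1) ⟨v, hn v hv, hvw⟩, Nat.cast_succ]
  · obtain ⟨k, -, hk⟩ := exists_steps_of_transGen (hS.2.1 v hv v₀ hv₀)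
    have e1 : ((n v + k : ℕ) : ZMod p) = 0 :=
      (ZMod.natCast_eq_zero_iff _ _).2 (Nat.setGcd_dvd_of_mem (s := P) ((hn v hv).trans hk))
    obtain ⟨q, hq⟩ : ∃ q, k + q + n w = 1 + L * (N + k + n w + 1) ∧ N ≤ q := by
      have : 1 * (N + k + n w + 1) ≤ L * (N + k + n w + 1) := Nat.mul_le_mul_right _ hL0
      exact ⟨1 + L * (N + k + n w + 1) - k - n w, by omega, by omega⟩
    have hqp : p ∣ q := by
      rw [← ZMod.natCast_eq_zero_iff]
      have e2 : ((L : ℕ) : ZMod p) = 0 := (ZMod.natCast_eq_zero_iff _ _).2 hLP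
      have e3 : ((k + q + n w : ℕ) : ZMod p) = ((1 + L * (N + k + n w + 1) : ℕ) : ZMod p) := by
        rw [hq.1]
      push_cast at e1 e3 hvw
      rw [e2, hvw] at e3
      linear_combination e3 - e1
    refine h2 _ ?_ ?_ v hv w hw ((hk.trans (hP (hN q hq.2 hqp))).trans (hn w hw))
    · rw [hq.1]
      have : L * 1 ≤ L * (N + k + n w + 1) := Nat.mul_le_mul_left _ (by omega)
      omega
    · rw [hq.1]
      simp [Nat.ModEq]

/-- Closed walks of length `4 * L` separate all pairs of residues that are not successive, and,
sharing their base point, separate walks in the range `[L, 3 * L)`. -/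
structure SeparatingLength (E : A → A → Prop) (L : ℕ) : Prop where
  pos : 0 < L
  separates : ∀ i j : ZMod (4 * L), j ≠ i + 1 → ∃ w, ClosedWalk E w ∧ ¬ E (w i) (w j)
  separates_two : ∀ i j : ZMod (4 * L), ∃ w w', ClosedWalk E w ∧ ClosedWalk E w' ∧
    ¬ E (w i) (w' j)
  separates_based : ∀ i : ℕ, L ≤ i → i < 3 * L → ∃ w w' : ZMod (4 * L) → A, ClosedWalk E w ∧
    ClosedWalk E w' ∧ w 0 = w' 0 ∧ ¬ E (w i) (w' (i + 1 : ℕ))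

lemma exists_separatingLength [Finite A] (h : ¬ ConditionD E) :
    ∃ L, SeparatingLength E L := by
  obtain ⟨L, hL⟩ := exists_stabilizesAt E
  have hL0 := hL.1
  have : NeZero (4 * L) := ⟨by omega⟩
  simp only [ConditionD, not_or, not_forall] at h
  obtain ⟨⟨Sr, hSr, hr⟩, ⟨Ss, hSs, hs⟩, ⟨S, hS, hp⟩⟩ := h
  have hforw : ∀ d, 2 ≤ d → ∃ u ∈ S, ∃ v ∈ S, Steps E d u v ∧ ¬ E u v := by
    intro d hd
    by_contra! hcon
    exact hp (hS.stateSplitType_of_steps hd hcon)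
  have hback : ∀ e, 2 ≤ e → ∃ u ∈ S, ∃ v ∈ S, Steps E e v u ∧ ¬ E u v := by
    intro e he
    by_contra! hcon
    have h1 : ∀ k, ∀ u ∈ S, ∀ v ∈ S, Steps E (e * k) u v → Steps E k v u := fun k => by
      induction k with
      | zero => exact fun u _ v _ h => Eq.symm h
      | succ k ih =>
        intro u hu v hv huv
        obtain ⟨x, hux, hxv⟩ := steps_add.1 huv
        have hx := hS.mem_of_steps hu hv hux hxv
        rw [add_comm k]
        exact (steps_one.2 (hcon v hv x hx hxv)).trans (ih u hu x hx hux)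
    refine hp (hS.stateSplitType_of_steps (d := e * e) (by nlinarith) fun u hu v hv huv => ?_)
    exact hcon u hu v hv (h1 e u hu v hv huv)
  refine ⟨L, hL0, fun i j hij => ?_, fun i j => ?_, fun i hi hi' => ?_⟩
  · have hj : i + ((j - i).val : ZMod (4 * L)) = j := by simp
    have hd4 := ZMod.val_lt (j - i)
    have hd1 : (j - i).val ≠ 1 := fun h1 => hij (by rw [← hj, h1]; simp)
    generalize (j - i).val = d at hj hd4 hd1
    have key : ∀ u v, Steps E d u v → Steps E (4 * L - d) v u → ¬ E u v →
        ∃ w : ZMod (4 * L) → A, ClosedWalk E w ∧ ¬ E (w i) (w j) := by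
      intro u v huv hvu hE
      obtain ⟨w, hw, hwi, hwj⟩ := exists_closedWalk (M := 4 * L) (by omega) huv hvu i
      rw [hj] at hwj
      exact ⟨w, hw, by rwa [hwi, hwj]⟩
    rcases d.eq_zero_or_pos with rfl | hd0
    · simp only [ReflexiveType, not_forall] at hr
      obtain ⟨u, hu, hE⟩ := hr
      refine key u u rfl (hL.return (u := u) (e := 0) rfl (hSr.2.1 u hu u hu) (by omega) ?_) hE
      exact Dvd.intro_left 4 rfl
    by_cases hd : d ≤ 2 * L
    · obtain ⟨u, hu, v, hv, huv, hE⟩ := hforw d (by omega)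
      refine key u v huv (hL.return huv (hS.2.1 v hv u hu) (by omega) ?_) hE
      rw [Nat.sub_add_cancel (by omega)]
      exact Dvd.intro_left 4 rfl
    · have hdvd : L ∣ d + (4 * L - d) := by
        rw [Nat.add_sub_cancel' (by omega)]
        exact Dvd.intro_left 4 rfl
      by_cases he : 4 * L - d = 1
      · simp only [SymmetricType, not_forall] at hs
        obtain ⟨v, hv, u, hu, -, hvu, hE⟩ := hs
        rw [← steps_one (E := E), ← he] at hvu
        exact key u v (hL.return hvu (hSs.2.1 u hu v hv) (by omega) hdvd) hvu hE
      · obtain ⟨u, hu, v, hv, hvu, hE⟩ := hback (4 * L - d) (by omega)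
        exact key u v (hL.return hvu (hS.2.1 u hu v hv) (by omega) hdvd) hvu hE
  · obtain ⟨u, hu, v, hv, -, hE⟩ := hforw 2 le_rfl
    have hloop : ∀ u ∈ S, ∀ i, ∃ w : ZMod (4 * L) → A, ClosedWalk E w ∧ w i = u := by
      intro u hu i
      obtain ⟨w, hw, hwi, -⟩ := exists_closedWalk (M := 4 * L) (d := 0) (zero_add _)
        (show Steps E 0 u u from rfl) (hL.return (u := u) (e := 0) rfl (hS.2.1 u hu u hu)
          (by omega) (Dvd.intro_left 4 rfl)) i
      exact ⟨w, hw, hwi⟩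
    obtain ⟨w, hw, hwi⟩ := hloop u hu i
    obtain ⟨w', hw', hwj⟩ := hloop v hv j
    exact ⟨w, w', hw, hw', by rwa [hwi, hwj]⟩
  · obtain ⟨a, ha, d, hd, had, hE⟩ := hforw (1 + L) (by omega)
    obtain ⟨x, hx, hax⟩ := hS.exists_steps ha (L * i - i)
    have hi0 : i ≤ L * i := Nat.le_mul_of_pos_left i hL0
    have hxa : Steps E i x a := by
      refine hL.return hax (hS.2.1 x hx a ha) hi ?_
      rw [Nat.add_sub_cancel' hi0]
      exact dvd_mul_right _ _
    have hxd : Steps E (i + 1) x d := by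
      rw [hL.steps_eq (k' := i + (1 + L)) (by omega) (by omega) (by simp [Nat.ModEq, ← add_assoc])]
      exact hxa.trans had
    have hback' : ∀ k, k ≤ 3 * L → ∀ y ∈ S, Steps E k x y → Steps E (4 * L - k) y x := by
      intro k hk y hy hxy
      refine hL.return hxy (hS.2.1 y hy x hx) (by omega) ?_
      rw [Nat.sub_add_cancel (by omega)]
      exact Dvd.intro_left 4 rfl
    obtain ⟨w, hw, hw0, hwi⟩ := exists_closedWalk (M := 4 * L) (by omega) hxa
      (hback' i (by omega) a ha hxa) 0
    obtain ⟨w', hw', hw0', hwi'⟩ := exists_closedWalk (M := 4 * L) (by omega) hxd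
      (hback' (i + 1) (by omega) d hd hxd) 0
    rw [zero_add] at hwi hwi'
    exact ⟨w, w', hw, hw', hw0.trans hw0'.symm, by rwa [hwi, hwi']⟩

end Walks

section Synchronization

lemma exists_emod_eq {n m : ℕ} (h : n.Coprime m) (x y : ℕ) (hx : x < n) (hy : y < m) :
    ∃ l : ℤ, l % n = x ∧ l % m = y := by
  obtain ⟨k, h1, h2⟩ := Nat.chineseRemainder h x y
  refine ⟨k, ?_, ?_⟩
  · rw [← Int.natCast_emod, h1, Nat.mod_eq_of_lt hx]
  · rw [← Int.natCast_emod, h2, Nat.mod_eq_of_lt hy]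

lemma exists_enumeration (W : Type*) [Finite W] [Nonempty W] :
    ∃ (Q : ℕ) (e : ℕ → W), 0 < Q ∧ ∀ w, ∃ k < Q, e k = w := by
  obtain ⟨Q, ⟨f⟩⟩ := Finite.exists_equiv_fin W
  have hQ : 0 < Q := (Nat.zero_le _).trans_lt (f (Classical.arbitrary W)).2
  exact ⟨Q, fun k => f.symm ⟨k % Q, Nat.mod_lt _ hQ⟩, hQ, fun w => ⟨f w, (f w).2, by
    simp [Nat.mod_eq_of_lt (f w).2]⟩⟩

lemma Int.emod_ne_of_lt {m : ℕ} {a b : ℤ} (h : a < b) (h' : b < a + m) : a % m ≠ b % m := by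
  intro heq
  have h1 : (m : ℤ) ∣ b - a := Int.ModEq.dvd heq
  have h2 := Int.le_of_dvd (by omega) h1
  omega

/-- A periodic sequence in which every ordered pair of letters occurs at every distance that is
not a multiple of the period. -/
lemma exists_sync_sequence (W : Type*) [Finite W] [Nonempty W] :
    ∃ (N : ℕ) (Ω : ℤ → W), 0 < N ∧ (∀ l, Ω (l + N) = Ω l) ∧ (∀ w, ∃ l, Ω l = w) ∧
      ∀ δ : ℤ, ¬ (N : ℤ) ∣ δ → ∀ w w', ∃ l, Ω l = w ∧ Ω (l + δ) = w' := by
  classical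
  obtain ⟨Q, e, hQ, he⟩ := exists_enumeration W
  let m := Q * (3 * Q)
  have hm : 0 < m := by positivity
  have : NeZero m := ⟨hm.ne'⟩
  obtain ⟨K, D, hK, hD⟩ := exists_enumeration (Fin m × W × W)
  let n := m * K + 1
  have hnm : n.Coprime m := by simp [n]
  have hKn : K < n := by
    have : 1 * K ≤ m * K := Nat.mul_le_mul_right _ hm
    omega
  let F : ℕ → ℕ → W := fun x y =>
    if x = 0 then e (y / (3 * Q)) else
      if y = 0 then (D (x - 1)).2.1 else
        if y = (D (x - 1)).1 then (D (x - 1)).2.2 else e (y % Q)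
  let Ω : ℤ → W := fun l => F (l % n).toNat (l % m).toNat
  have key : ∀ δ : ℤ, ¬ ((n * m : ℕ) : ℤ) ∣ δ → ∀ w w', ∃ l, Ω l = w ∧ Ω (l + δ) = w' := by
    intro δ hδ w w'
    by_cases hn : (n : ℤ) ∣ δ
    · have hm' : ¬ (m : ℤ) ∣ δ := fun h => hδ (by
        push_cast
        exact (Nat.isCoprime_iff_coprime.2 hnm).mul_dvd hn h)
      have hδ0 : 0 < δ % m := lt_of_le_of_ne (Int.emod_nonneg _ (by omega))
        fun h => hm' (Int.dvd_of_emod_eq_zero h.symm)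
      have hδm : δ % m < m := Int.emod_lt_of_pos _ (by omega)
      obtain ⟨x, hx, hDx⟩ := hD (⟨(δ % m).toNat, by omega⟩, w, w')
      obtain ⟨l, hl1, hl2⟩ := exists_emod_eq hnm (x + 1) 0 (by omega) hm
      have h1 : (l + δ) % n = (x + 1 : ℕ) := by
        rw [Int.add_emod, Int.emod_eq_zero_of_dvd hn, add_zero, Int.emod_emod_of_dvd _ dvd_rfl,
          hl1]
      have h2 : (l + δ) % m = δ % m := by
        rw [Int.add_emod, hl2]; simp
      refine ⟨l, ?_, ?_⟩
      · simp only [Ω, hl1, hl2, Int.toNat_natCast, F, if_true, Nat.succ_ne_zero, if_false,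
          Nat.add_sub_cancel, hDx]
      · simp only [Ω, h1, h2, Int.toNat_natCast, F, if_true, Nat.succ_ne_zero, if_false,
          Nat.add_sub_cancel, hDx]
        rw [if_neg (by omega)]
    · obtain ⟨k, hk, rfl⟩ := he w
      obtain ⟨k', hk', rfl⟩ := he w'
      have hδ0 : 0 < δ % n := lt_of_le_of_ne (Int.emod_nonneg _ (by omega))
        fun h => hn (Int.dvd_of_emod_eq_zero h.symm)
      obtain ⟨x, hx⟩ : ∃ x : ℕ, δ % n = (x + 1 : ℕ) := ⟨(δ % n).toNat - 1, by omega⟩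
      let c := (k' - δ) % Q
      have hc0 : 0 ≤ c := Int.emod_nonneg _ (by omega)
      have hcQ : c < Q := Int.emod_lt_of_pos _ (by omega)
      have hkm : 3 * Q * k + 3 * Q ≤ m := by
        have := Nat.mul_le_mul_left (3 * Q) (Nat.succ_le_of_lt hk)
        have e1 : m = 3 * Q * Q := by dsimp only [m]; ring
        rw [Nat.mul_succ] at this
        omega
      obtain ⟨t, ht, ht0, htD⟩ : ∃ t : ℕ, t < 3 ∧
          ((3 * Q * k + Q * t : ℕ) + c + δ) % (m : ℤ) ≠ 0 ∧
          ((3 * Q * k + Q * t : ℕ) + c + δ) % (m : ℤ) ≠ ((D x).1 : ℕ) := by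
        by_contra! hcon
        have h0 := hcon 0 (by norm_num)
        have h1 := hcon 1 (by norm_num)
        have h2 := hcon 2 (by norm_num)
        have h01 := Int.emod_ne_of_lt (m := m) (a := (3 * Q * k + Q * 0 : ℕ) + c + δ)
          (b := (3 * Q * k + Q * 1 : ℕ) + c + δ) (by push_cast; omega)
          (by push_cast at *; omega)
        have h02 := Int.emod_ne_of_lt (m := m) (a := (3 * Q * k + Q * 0 : ℕ) + c + δ)
          (b := (3 * Q * k + Q * 2 : ℕ) + c + δ) (by push_cast; omega)
          (by push_cast at *; omega)
        have h12 := Int.emod_ne_of_lt (m := m) (a := (3 * Q * k + Q * 1 : ℕ) + c + δ)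
          (b := (3 * Q * k + Q * 2 : ℕ) + c + δ) (by push_cast; omega)
          (by push_cast at *; omega)
        grind
      have hQt : Q * t ≤ Q * 2 := Nat.mul_le_mul_left _ (by omega)
      obtain ⟨y, hy⟩ : ∃ y : ℕ, (y : ℤ) = (3 * Q * k + Q * t : ℕ) + c :=
        ⟨3 * Q * k + Q * t + c.toNat, by push_cast; omega⟩
      have hyl : 3 * Q * k ≤ y := by zify; rw [hy]; push_cast; nlinarith
      have hyu : y < 3 * Q * k + 3 * Q := by
        have hQt' : (Q : ℤ) * t ≤ Q * 2 := by exact_mod_cast hQt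
        zify
        rw [hy]
        push_cast
        linarith
      obtain ⟨l, hl1, hl2⟩ := exists_emod_eq hnm 0 y (by omega) (by omega)
      have h1 : (l + δ) % n = (x + 1 : ℕ) := by
        rw [Int.add_emod, hl1, hx]
        rw [← hx]
        simp
      have h2 : (l + δ) % m = ((3 * Q * k + Q * t : ℕ) + c + δ) % (m : ℤ) := by
        rw [← hy, ← hl2]
        simp
      have h3 : (((l + δ) % m).toNat : ℤ) = (l + δ) % m :=
        Int.toNat_of_nonneg (Int.emod_nonneg _ (by omega))
      refine ⟨l, ?_, ?_⟩
      · simp only [Ω, hl1, hl2, Int.toNat_natCast, F, if_true]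
        congr 1
        rw [Nat.div_eq_iff (by omega), mul_comm k]
        omega
      · simp only [Ω, h1, Int.toNat_natCast, F, Nat.succ_ne_zero, if_false,
          Nat.add_sub_cancel]
        rw [if_neg (by omega), if_neg (by omega)]
        congr 1
        zify
        have hQm : (Q : ℤ) ∣ m := by exact_mod_cast Dvd.intro (3 * Q) rfl
        have h4 : (Q : ℤ) ∣ l + δ - k' := by
          have e1 : (Q : ℤ) ∣ l - y := hQm.trans (by
            rw [← hl2]
            exact Int.dvd_self_sub_emod)
          have e2 : (Q : ℤ) ∣ (k' - δ) - c := Int.dvd_self_sub_emod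
          have e3 : l + δ - k' = (l - y) - ((k' - δ) - c) + Q * (3 * k + t) := by
            rw [hy]
            push_cast
            ring
          rw [e3]
          exact dvd_add (dvd_sub e1 e2) (dvd_mul_right _ _)
        rw [h3, Int.emod_emod_of_dvd _ hQm,
          Int.emod_eq_emod_iff_emod_sub_eq_zero.2 (Int.emod_eq_zero_of_dvd h4),
          Int.emod_eq_of_lt (by omega) (by omega)]
  have hN : 1 < n * m := by
    have : 1 * 1 ≤ m * K := Nat.mul_le_mul hm hK
    have : n * 1 ≤ n * m := Nat.mul_le_mul_left _ hm
    omega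
  refine ⟨n * m, Ω, by omega, fun l => ?_, fun w => ?_, key⟩
  · simp only [Ω]
    push_cast
    rw [Int.add_mul_emod_self_left, Int.add_mul_emod_self_right]
  · obtain ⟨l, hl, -⟩ := key 1 (fun h => by
      have := Int.le_of_dvd one_pos h
      push_cast at *
      omega) w w
    exact ⟨l, hl⟩

end Synchronization

section Simulation

/-- `Ω` is a vertical sequence, of period `N`, of codes assigning to a phase modulo `4 * L` and a
pair of tiles a letter. The first tile may change only when entering phase `0`, the second one only
when entering phase `2 * L`. Letters of adjacent columns determine the alignment, the phase, and,
on half of the phases each, the two tiles. -/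
structure IsCode {A T : Type*} (E : A → A → Prop) (L N : ℕ)
    (Ω : ℤ → ZMod (4 * L) → T × T → A) : Prop where
  length_pos : 0 < L
  period_pos : 0 < N
  periodic : ∀ l, Ω (l + N) = Ω l
  edge : ∀ l (i : ZMod (4 * L)) (s t : T × T), (i + 1 ≠ 0 → s.1 = t.1) →
    (i + 1 ≠ (2 * L : ℕ) → s.2 = t.2) → E (Ω l i s) (Ω l (i + 1) t)
  align : ∀ δ : ℤ, ¬ (N : ℤ) ∣ δ → ∀ i j : ZMod (4 * L), ∃ l, ∀ s t, ¬ E (Ω l i s) (Ω (l + δ) j t)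
  phase : ∀ i j : ZMod (4 * L), j ≠ i + 1 → ∃ l, ∀ s t, ¬ E (Ω l i s) (Ω l j t)
  read_fst : ∀ i : ℕ, L ≤ i → i < 3 * L → ∀ s t : T × T, s.1 ≠ t.1 →
    ∃ l, ¬ E (Ω l (i : ℕ) s) (Ω l (i + 1 : ℕ) t)
  read_snd : ∀ i : ℕ, L ≤ i → i < 3 * L → ∀ s t : T × T, s.2 ≠ t.2 →
    ∃ l, ¬ E (Ω l (i + 2 * L : ℕ) s) (Ω l (i + 1 + 2 * L : ℕ) t)

variable {A T : Type*} {E : A → A → Prop} {L N : ℕ} {Ω : ℤ → ZMod (4 * L) → T × T → A}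

lemma SeparatingLength.exists_isCode [Finite A] [Finite T] [Nonempty T]
    (hL : SeparatingLength E L) :
    ∃ (N : ℕ) (Ω : ℤ → ZMod (4 * L) → T × T → A), IsCode E L N Ω := by
  classical
  have : NeZero (4 * L) := ⟨by have := hL.pos; omega⟩
  let W := {φ : ZMod (4 * L) → T × T → A // ∀ (i : ZMod (4 * L)) (s t : T × T), (i + 1 ≠ 0 → s.1 = t.1) →
    (i + 1 ≠ (2 * L : ℕ) → s.2 = t.2) → E (φ i s) (φ (i + 1) t)}
  have hphase (w : ZMod (4 * L) → A) (hw : ClosedWalk E w) :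
      ∃ φ : W, φ.1 = fun i _ => w i := ⟨⟨fun i _ => w i, fun i s t _ _ => hw i⟩, rfl⟩
  obtain ⟨w₀, -, hw₀, -⟩ := hL.separates_two 0 0
  have : Nonempty W := ⟨(hphase w₀ hw₀).choose⟩
  have : Finite W := Subtype.finite
  obtain ⟨N, Ω, hN, hper, hsurj, hsync⟩ := exists_sync_sequence W
  refine ⟨N, fun l => (Ω l).1, hL.pos, hN, fun l => by rw [hper], fun l => (Ω l).2, ?_, ?_, ?_, ?_⟩
  · intro δ hδ i j
    obtain ⟨w, w', hw, hw', h⟩ := hL.separates_two i j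
    obtain ⟨φ, hφ⟩ := hphase w hw
    obtain ⟨φ', hφ'⟩ := hphase w' hw'
    obtain ⟨l, rfl, rfl⟩ := hsync δ hδ φ φ'
    exact ⟨l, fun s t => by rwa [hφ, hφ']⟩
  · intro i j hij
    obtain ⟨w, hw, h⟩ := hL.separates i j hij
    obtain ⟨φ, hφ⟩ := hphase w hw
    obtain ⟨l, rfl⟩ := hsurj φ
    exact ⟨l, fun s t => by rwa [hφ]⟩
  · intro i h1 h2 s t hst
    obtain ⟨w, w', hw, hw', h0, h⟩ := hL.separates_based i h1 h2
    obtain ⟨l, hl⟩ := hsurj ⟨fun z u => if u.1 = s.1 then w z else w' z, fun z u v h' _ => by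
      dsimp only
      by_cases hz : z + 1 = 0
      · have e1 := hw z
        have e2 := hw' z
        rw [hz] at e1 e2 ⊢
        rw [← h0] at e2 ⊢
        split_ifs <;> assumption
      · rw [h' hz]
        split_ifs
        exacts [hw z, hw' z]⟩
    refine ⟨l, ?_⟩
    rw [hl]
    simpa [Ne.symm hst] using h
  · intro i h1 h2 s t hst
    obtain ⟨w, w', hw, hw', h0, h⟩ := hL.separates_based i h1 h2
    obtain ⟨l, hl⟩ := hsurj ⟨fun z u =>
        if u.2 = s.2 then w (z - (2 * L : ℕ)) else w' (z - (2 * L : ℕ)), fun z u v _ h' => by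
      dsimp only
      have e1 := hw (z - (2 * L : ℕ))
      have e2 := hw' (z - (2 * L : ℕ))
      rw [sub_add_eq_add_sub] at e1 e2
      by_cases hz : z + 1 = (2 * L : ℕ)
      · rw [hz, sub_self] at e1 e2 ⊢
        rw [← h0] at e2 ⊢
        split_ifs <;> assumption
      · rw [h' hz]
        split_ifs <;> assumption⟩
    refine ⟨l, ?_⟩
    rw [hl]
    have e1 : ((i + 2 * L : ℕ) : ZMod (4 * L)) - (2 * L : ℕ) = i := by push_cast; ring
    have e2 : ((i + 1 + 2 * L : ℕ) : ZMod (4 * L)) - (2 * L : ℕ) = (i + 1 : ℕ) := by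
      push_cast; ring
    simpa only [if_true, if_neg (Ne.symm hst), e1, e2] using h

namespace IsCode

lemma periodic_mul (hΩ : IsCode E L N Ω) (l k : ℤ) : Ω (l + N * k) = Ω l := by
  induction k with
  | zero => simp
  | succ k ih => rw [mul_add, mul_one, ← add_assoc, hΩ.periodic, ih]
  | pred k ih => rw [← ih, ← hΩ.periodic (l + N * (-k - 1))]; congr 1; ring

lemma eq_of_dvd (hΩ : IsCode E L N Ω) {l m : ℤ} (h : (N : ℤ) ∣ m - l) : Ω m = Ω l := by
  obtain ⟨k, hk⟩ := h
  rw [← hΩ.periodic_mul l k, ← hk]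
  congr 1
  ring

lemma exists_mem_window (hΩ : IsCode E L N Ω) (l₀ l : ℤ) :
    ∃ m, l₀ ≤ m ∧ m < l₀ + N ∧ (N : ℤ) ∣ m - l := by
  have hN := hΩ.period_pos
  refine ⟨l₀ + (l - l₀) % N, ?_, ?_, ?_⟩
  · have := Int.emod_nonneg (l - l₀) (b := N) (by omega)
    omega
  · have := Int.emod_lt_of_pos (l - l₀) (b := N) (by omega)
    omega
  · have : (N : ℤ) ∣ (l - l₀) - (l - l₀) % N := Int.dvd_self_sub_emod
    rw [← dvd_neg, neg_sub]
    rwa [show l - (l₀ + (l - l₀) % N) = l - l₀ - (l - l₀) % N by ring]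

/-- Adjacent coded columns are aligned and have consecutive phases. -/
lemma dvd_and_eq_add_one (hΩ : IsCode E L N Ω) {l₀ r r' : ℤ} {i i' : ZMod (4 * L)}
    {s s' : ℤ → T × T}
    (h : ∀ l, l₀ ≤ l → l < l₀ + N → E (Ω (l + r) i (s l)) (Ω (l + r') i' (s' l))) :
    (N : ℤ) ∣ r' - r ∧ i' = i + 1 := by
  have key : (N : ℤ) ∣ r' - r := by
    by_contra hr
    obtain ⟨l, hl⟩ := hΩ.align _ hr i i'
    obtain ⟨m, h1, h2, h3⟩ := hΩ.exists_mem_window l₀ (l - r)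
    have := h m h1 h2
    rw [hΩ.eq_of_dvd (l := l) (m := m + r) (by convert h3 using 1; ring),
      hΩ.eq_of_dvd (l := l + (r' - r)) (m := m + r') (by convert h3 using 1; ring)] at this
    exact hl _ _ this
  refine ⟨key, ?_⟩
  by_contra hi
  obtain ⟨l, hl⟩ := hΩ.phase _ _ hi
  obtain ⟨m, h1, h2, h3⟩ := hΩ.exists_mem_window l₀ (l - r)
  have := h m h1 h2
  rw [hΩ.eq_of_dvd (l := m + r) (m := m + r') (by convert key using 1; ring),
    hΩ.eq_of_dvd (l := l) (m := m + r) (by convert h3 using 1; ring)] at this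
  exact hl _ _ this

lemma forall_of_window (hΩ : IsCode E L N Ω) {l₀ r r' : ℤ} (hr : (N : ℤ) ∣ r' - r)
    {i i' : ZMod (4 * L)} {s t : T × T}
    (h : ∀ l, l₀ ≤ l → l < l₀ + N → E (Ω (l + r) i s) (Ω (l + r') i' t)) (l : ℤ) :
    E (Ω l i s) (Ω l i' t) := by
  obtain ⟨m, h1, h2, h3⟩ := hΩ.exists_mem_window l₀ (l - r)
  have := h m h1 h2
  rwa [hΩ.eq_of_dvd (l := m + r) (m := m + r') (by convert hr using 1; ring),
    hΩ.eq_of_dvd (l := l) (m := m + r) (by convert h3 using 1; ring)] at this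

end IsCode

lemma isSFT1_setOf_window {A : Type*} [Finite A] (K : ℕ) (P : (ℤ → A) → Prop)
    (hP : ∀ y y' : ℤ → A, (∀ n : ℤ, 0 ≤ n → n < K → y n = y' n) → P y → P y') :
    IsSFT1 {y : ℤ → A | ∀ l : ℤ, P fun n => y (l + n)} := by
  have hfin : {w : List A | ∃ y, ¬ P y ∧ w = List.ofFn fun n : Fin K => y (n : ℕ)}.Finite :=
    (List.finite_length_eq A K).subset (by rintro _ ⟨y, -, rfl⟩; simp)
  refine ⟨hfin.toFinset, ?_⟩
  ext y
  simp only [SFT1, Set.mem_ofPred_eq, Set.Finite.mem_toFinset]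
  constructor
  · rintro h _ ⟨y', hy', rfl⟩ ⟨l, hl⟩
    refine hy' (hP _ _ (fun n hn hn' => ?_) (h l))
    lift n to ℕ using hn
    simpa using hl n (by simpa using hn')
  · intro h l
    by_contra hl
    exact h _ ⟨_, hl, rfl⟩ ⟨l, fun n hn => by simp⟩

/-- The word `y 0, …, y (2 * N - 1)` is read along a coded column of phase `i`, with vertical
offset `r`, in which the tiles `s 0` and `s 1` satisfy the matching constraints. -/
def CodedWindow (Ω : ℤ → ZMod (4 * L) → T × T → A) (N : ℕ) (HM VM : T → T → Prop)
    (r : ℤ) (i : ZMod (4 * L)) (s : ℤ → T × T) (y : ℤ → A) : Prop :=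
  (∀ n : ℤ, 0 ≤ n → n < 2 * N → y n = Ω (n + r) i (s ((n + r) / N))) ∧
  (i = (L : ℕ) → HM (s 0).2 (s 0).1 ∧ VM (s 0).1 (s 1).1) ∧
  (i = (3 * L : ℕ) → (s 0).1 = (s 0).2)

/-- Sequences all of whose windows are coded. -/
def codedColumns (Ω : ℤ → ZMod (4 * L) → T × T → A) (N : ℕ) (HM VM : T → T → Prop) :
    Set (ℤ → A) :=
  {y | ∀ l : ℤ, ∃ (r : ℤ) (i : ZMod (4 * L)) (s : ℤ → T × T), 0 ≤ r ∧ r < N ∧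
    CodedWindow Ω N HM VM r i s fun n => y (l + n)}

lemma isSFT1_codedColumns [Finite A] (Ω : ℤ → ZMod (4 * L) → T × T → A) (N : ℕ)
    (HM VM : T → T → Prop) : IsSFT1 (codedColumns Ω N HM VM) := by
  refine isSFT1_setOf_window (2 * N) (fun y => ∃ r i s, 0 ≤ r ∧ r < (N : ℤ) ∧
    CodedWindow Ω N HM VM r i s y) ?_
  rintro y y' h ⟨r, i, s, h0, h1, h2, h3⟩
  exact ⟨r, i, s, h0, h1, fun n hn hn' => by rw [← h n hn (by exact_mod_cast hn'), h2 n hn hn'],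
    h3⟩

lemma four_mul_cast (L : ℕ) : (4 * L : ZMod (4 * L)) = 0 := by
  have := ZMod.natCast_self (4 * L)
  push_cast at this
  exact this

lemma cast_mul_add (L : ℕ) (m k : ℤ) : ((4 * L * m + k : ℤ) : ZMod (4 * L)) = k := by
  push_cast
  rw [four_mul_cast]
  ring

namespace IsCode

variable {HM VM : T → T → Prop}

lemma fst_eq (hΩ : IsCode E L N Ω) {m k : ℤ} (hk : L ≤ k) (hk' : k < 3 * L) {s t : T × T}
    (h : ∀ l, E (Ω l (4 * L * m + k : ℤ) s) (Ω l ((4 * L * m + k : ℤ) + 1) t)) : s.1 = t.1 := by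
  by_contra hst
  lift k to ℕ using by omega
  obtain ⟨l, hl⟩ := hΩ.read_fst k (by omega) (by omega) s t hst
  have e : ((4 * L * m + k : ℤ) : ZMod (4 * L)) = (k : ℕ) := by
    rw [cast_mul_add]
    simp
  have := h l
  rw [e] at this
  exact hl (by simpa using this)

lemma snd_eq (hΩ : IsCode E L N Ω) {m k : ℤ} (hk : L ≤ k) (hk' : k < 3 * L) {s t : T × T}
    (h : ∀ l, E (Ω l (4 * L * m + 2 * L + k : ℤ) s)
      (Ω l ((4 * L * m + 2 * L + k : ℤ) + 1) t)) : s.2 = t.2 := by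
  by_contra hst
  lift k to ℕ using by omega
  obtain ⟨l, hl⟩ := hΩ.read_snd k (by omega) (by omega) s t hst
  have e : ((4 * L * m + 2 * L + k : ℤ) : ZMod (4 * L)) = (k + 2 * L : ℕ) := by
    rw [add_assoc, cast_mul_add]
    push_cast
    ring
  have := h l
  rw [e] at this
  refine hl ?_
  convert this using 2
  push_cast
  ring

/-- The stacks of tiles `u` and `u'` coded by an aligned configuration: `u' c b` is the tile pair
in block `b + 1` as it is seen from block `b`. -/
structure IsStack (Ω : ℤ → ZMod (4 * L) → T × T → A) (N : ℕ) (HM VM : T → T → Prop)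
    (u u' : ℤ → ℤ → T × T) (y : ℤ → ℤ → A) : Prop where
  eq_code : ∀ c l, y c l = Ω l c (u c (l / N))
  eq_code' : ∀ c l, y c l = Ω l c (u' c (l / N - 1))
  hmatch : ∀ c : ℤ, (c : ZMod (4 * L)) = (L : ℕ) → ∀ b, HM (u c b).2 (u c b).1
  vmatch : ∀ c : ℤ, (c : ZMod (4 * L)) = (L : ℕ) → ∀ b, VM (u c b).1 (u' c b).1
  fst_eq_snd : ∀ c : ℤ, (c : ZMod (4 * L)) = (3 * L : ℕ) → ∀ b, (u c b).1 = (u c b).2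

lemma exists_isStack (hΩ : IsCode E L N Ω) {x : ℤ × ℤ → A}
    (hx : x ∈ XHV (vertexShift E) (codedColumns Ω N HM VM)) :
    ∃ (c₀ r₀ : ℤ) (u u' : ℤ → ℤ → T × T),
      IsStack Ω N HM VM u u' fun c l => x (c + c₀, l + r₀) := by
  obtain ⟨hrow, hcol⟩ := hx
  have hN := hΩ.period_pos
  have : NeZero (4 * L) := ⟨by have := hΩ.length_pos; omega⟩
  choose r i s h0 hrN hw using hcol
  have hE (c l : ℤ) : E (x (c, l)) (x (c + 1, l)) := hrow l c
  have hval (c l l' : ℤ) (h1 : l ≤ l') (h2 : l' < l + 2 * N) :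
      x (c, l') = Ω (l' + (r c l - l)) (i c l) (s c l ((l' + (r c l - l)) / N)) := by
    have := (hw c l).1 (l' - l) (by omega) (by omega)
    dsimp only at this
    rw [add_sub_cancel] at this
    rw [this, show l' - l + r c l = l' + (r c l - l) by ring]
  have hadj (c l l' : ℤ) (h1 : l ≤ l' + N) (h2 : l' ≤ l + N) :
      (N : ℤ) ∣ (r (c + 1) l' - l') - (r c l - l) ∧ i (c + 1) l' = i c l + 1 := by
    refine hΩ.dvd_and_eq_add_one (l₀ := max l l')
      (s := fun m => s c l ((m + (r c l - l)) / N))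
      (s' := fun m => s (c + 1) l' ((m + (r (c + 1) l' - l')) / N)) fun m hm hm' => ?_
    rw [← hval c l m (by omega) (by omega), ← hval (c + 1) l' m (by omega) (by omega)]
    exact hE c m
  have hv (c l : ℤ) : (N : ℤ) ∣ (r c l - l) - r c 0 ∧ i c l = i c 0 := by
    have hstep (l : ℤ) : (N : ℤ) ∣ (r c (l + 1) - (l + 1)) - (r c l - l) ∧
        i c (l + 1) = i c l := by
      obtain ⟨h1, h2⟩ := hadj c l l (by omega) (by omega)
      obtain ⟨h3, h4⟩ := hadj c (l + 1) l (by omega) (by omega)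
      refine ⟨?_, by rw [h2] at h4; exact (add_right_cancel h4).symm⟩
      exact (dvd_sub h1 h3).trans (dvd_of_eq (by ring))
    induction l with
    | zero => simp
    | succ l ih =>
      obtain ⟨h1, h2⟩ := hstep l
      refine ⟨?_, h2.trans ih.2⟩
      exact (dvd_add h1 ih.1).trans (dvd_of_eq (by ring))
    | pred l ih =>
      obtain ⟨h1, h2⟩ := hstep (-l - 1)
      rw [sub_add_cancel] at h1 h2
      refine ⟨?_, h2.symm.trans ih.2⟩
      exact (dvd_sub ih.1 h1).trans (dvd_of_eq (by ring))
  have hh (c : ℤ) : (N : ℤ) ∣ r c 0 - r 0 0 ∧ i c 0 = i 0 0 + c := by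
    induction c with
    | zero => simp
    | succ c ih =>
      obtain ⟨h1, h2⟩ := hadj c 0 0 (by omega) (by omega)
      refine ⟨?_, by rw [h2, ih.2]; push_cast; ring⟩
      exact (dvd_add h1 ih.1).trans (dvd_of_eq (by ring))
    | pred c ih =>
      obtain ⟨h1, h2⟩ := hadj (-c - 1) 0 0 (by omega) (by omega)
      rw [sub_add_cancel] at h1 h2
      refine ⟨?_, ?_⟩
      · exact (dvd_sub ih.1 h1).trans (dvd_of_eq (by ring))
      · rw [ih.2] at h2
        rw [← add_right_cancel_iff (a := (1 : ZMod (4 * L))), ← h2]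
        push_cast
        ring
  let c₀ : ℤ := -((i 0 0).val : ℤ)
  let r₀ : ℤ := -r 0 0
  have hi (c l : ℤ) : i (c + c₀) l = c := by
    rw [(hv _ _).2, (hh _).2]
    simp [c₀]
  have hr (c b : ℤ) : r c (N * b + r₀) = 0 := by
    have h1 : (N : ℤ) ∣ r c (N * b + r₀) := by
      have := dvd_add (dvd_add (hv c (N * b + r₀)).1 (hh c).1) (dvd_mul_right (N : ℤ) b)
      exact this.trans (dvd_of_eq (by simp only [r₀]; ring))
    exact Int.eq_zero_of_dvd_of_nonneg_of_lt (h0 _ _) (hrN _ _) h1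
  have hdecomp (l : ℤ) := Int.emod_add_mul_ediv l N
  have hlt (l : ℤ) := Int.emod_lt_of_pos l (b := N) (by omega)
  have hnn (l : ℤ) := Int.emod_nonneg l (b := N) (by omega)
  refine ⟨c₀, r₀, fun c b => s (c + c₀) (N * b + r₀) 0, fun c b => s (c + c₀) (N * b + r₀) 1,
    fun c l => ?_, fun c l => ?_, fun c hc b => ?_, fun c hc b => ?_, fun c hc b => ?_⟩
  · have := (hw (c + c₀) (N * (l / N) + r₀)).1 (l % N) (hnn l) (by linarith [hlt l])
    dsimp only at this
    rw [hr, hi, add_zero, Int.ediv_eq_zero_of_lt (hnn l) (hlt l)] at this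
    rw [show l + r₀ = N * (l / N) + r₀ + l % N by linarith [hdecomp l], this,
      hΩ.eq_of_dvd (l := l) (m := l % N)]
    exact ⟨-(l / N), by linarith [hdecomp l]⟩
  · have := (hw (c + c₀) (N * (l / N - 1) + r₀)).1 (l % N + N) (by linarith [hnn l])
      (by linarith [hlt l])
    dsimp only at this
    rw [hr, hi, add_zero, Int.add_ediv_of_dvd_right dvd_rfl,
      Int.ediv_eq_zero_of_lt (hnn l) (hlt l), Int.ediv_self (by omega), zero_add] at this
    rw [show l + r₀ = N * (l / N - 1) + r₀ + (l % N + N) by linarith [hdecomp l], this,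
      hΩ.eq_of_dvd (l := l) (m := l % N + N)]
    exact ⟨-(l / N) + 1, by linarith [hdecomp l]⟩
  · exact ((hw (c + c₀) (N * b + r₀)).2.1 (by rw [hi, hc])).1
  · exact ((hw (c + c₀) (N * b + r₀)).2.1 (by rw [hi, hc])).2
  · exact (hw (c + c₀) (N * b + r₀)).2.2 (by rw [hi, hc])

namespace IsStack

variable {u u' : ℤ → ℤ → T × T} {y : ℤ → ℤ → A}

lemma edge (hs : IsStack Ω N HM VM u u' y) (hΩ : IsCode E L N Ω) {c c' q : ℤ}
    (h : ∀ l, E (y c l) (y c' (l + N * q))) (b l : ℤ) :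
    E (Ω l c (u c b)) (Ω l c' (u c' (b + q))) := by
  have hN := hΩ.period_pos
  refine hΩ.forall_of_window (l₀ := N * b) (r := 0) (r' := N * q) (by simp) (fun m h1 h2 => ?_) l
  have hb : m / N = b := by
    rw [Int.ediv_eq_iff_of_pos (by omega)]
    constructor <;> linarith
  have := h m
  rw [hs.eq_code, hs.eq_code, Int.add_mul_ediv_left _ _ (by omega), hb] at this
  rwa [add_zero]

lemma edge' (hs : IsStack Ω N HM VM u u' y) (hΩ : IsCode E L N Ω)
    (hy : ∀ c l, E (y c l) (y (c + 1) l)) (c b l : ℤ) :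
    E (Ω l c (u' c b)) (Ω l (c + 1) (u (c + 1) (b + 1))) := by
  have hN := hΩ.period_pos
  refine hΩ.forall_of_window (l₀ := N * (b + 1)) (r := 0) (r' := 0) (by simp)
    (fun m h1 h2 => ?_) l
  have hb : m / N = b + 1 := by
    rw [Int.ediv_eq_iff_of_pos (by omega)]
    constructor <;> linarith
  have := hy c m
  rw [hs.eq_code' c, hs.eq_code (c + 1), hb, add_sub_cancel_right] at this
  simpa using this

lemma edge_succ (hs : IsStack Ω N HM VM u u' y) (hΩ : IsCode E L N Ω)
    (hy : ∀ c l, E (y c l) (y (c + 1) l)) (c b l : ℤ) :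
    E (Ω l c (u c b)) (Ω l (c + 1) (u (c + 1) b)) := by
  simpa using hs.edge hΩ (c := c) (c' := c + 1) (q := 0) (by simpa using hy c) b l

lemma fst_eq_of_le (hs : IsStack Ω N HM VM u u' y) (hΩ : IsCode E L N Ω)
    (hy : ∀ c l, E (y c l) (y (c + 1) l)) (m b : ℤ) (k : ℤ) (hk : L ≤ k) (hk' : k ≤ 3 * L) :
    (u (4 * L * m + k) b).1 = (u (4 * L * m + L) b).1 := by
  induction k, hk using Int.leInduction with
  | base => rfl
  | succ k hk ih =>
    rw [← ih (by omega), hΩ.fst_eq hk (by omega) (hs.edge_succ hΩ hy _ b), add_assoc]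

lemma snd_eq_of_le (hs : IsStack Ω N HM VM u u' y) (hΩ : IsCode E L N Ω)
    (hy : ∀ c l, E (y c l) (y (c + 1) l)) (m b : ℤ) (k : ℤ) (hk : L ≤ k) (hk' : k ≤ 3 * L) :
    (u (4 * L * m + 2 * L + k) b).2 = (u (4 * L * m + 2 * L + L) b).2 := by
  induction k, hk using Int.leInduction with
  | base => rfl
  | succ k hk ih =>
    rw [← ih (by omega), hΩ.snd_eq hk (by omega) (hs.edge_succ hΩ hy _ b), add_assoc _ k]

lemma hMatch (hs : IsStack Ω N HM VM u u' y) (hΩ : IsCode E L N Ω)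
    (hy : ∀ c l, E (y c l) (y (c + 1) l)) (m b : ℤ) :
    HM (u (4 * L * m + L) b).1 (u (4 * L * (m + 1) + L) b).1 := by
  have h1 := hs.hmatch (4 * L * (m + 1) + L) (by rw [cast_mul_add]; simp) b
  have h2 := hs.snd_eq_of_le hΩ hy m b (3 * L) (by omega) le_rfl
  have h3 := hs.fst_eq_snd (4 * L * m + 3 * L) (by rw [cast_mul_add]; push_cast; ring) b
  have h4 := hs.fst_eq_of_le hΩ hy m b (3 * L) (by omega) le_rfl
  rw [show (4 * L * m + 2 * L + 3 * L : ℤ) = 4 * L * (m + 1) + L by ring,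
    show (4 * L * m + 2 * L + L : ℤ) = 4 * L * m + 3 * L by ring, ← h3, h4] at h2
  rwa [h2] at h1

lemma vMatch (hs : IsStack Ω N HM VM u u' y) (hΩ : IsCode E L N Ω)
    (hy : ∀ c l, E (y c l) (y (c + 1) l)) (m b : ℤ) :
    VM (u (4 * L * m + L) b).1 (u (4 * L * m + L) (b + 1)).1 := by
  have hL := hΩ.length_pos
  have h1 := hs.vmatch (4 * L * m + L) (by rw [cast_mul_add]; simp) b
  have h2 := hΩ.fst_eq (m := m) le_rfl (by omega) (hs.edge' hΩ hy _ b)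
  have h3 := hΩ.fst_eq (m := m) le_rfl (by omega) (hs.edge_succ hΩ hy _ (b + 1))
  rwa [h2, ← h3] at h1

lemma exists_period (hs : IsStack Ω N HM VM u u' y) (hΩ : IsCode E L N Ω)
    (hy : ∀ c l, E (y c l) (y (c + 1) l)) {p q : ℤ} (hper : ∀ c l, y (c + p) (l + q) = y c l) :
    ∃ p' q', p = 4 * L * p' ∧ q = N * q' ∧
      ∀ m b, (u (4 * L * (m + p') + L) (b + q')).1 = (u (4 * L * m + L) b).1 := by
  have hL := hΩ.length_pos
  have hE (c l : ℤ) : E (y c l) (y (c + 1 + p) (l + q)) := by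
    rw [hper]
    exact hy c l
  obtain ⟨hq, hp⟩ := hΩ.dvd_and_eq_add_one (l₀ := 0) (r := 0) (r' := q) (i := (0 : ℤ))
    (i' := (0 + 1 + p : ℤ)) (s := fun l => u 0 (l / N))
    (s' := fun l => u (0 + 1 + p) ((l + q) / N)) fun l _ _ => by
      have := hE 0 l
      rw [hs.eq_code, hs.eq_code] at this
      simpa using this
  rw [sub_zero] at hq
  obtain ⟨q', rfl⟩ := hq
  have hp' : ((4 * L : ℕ) : ℤ) ∣ p := by
    rw [← ZMod.intCast_zmod_eq_zero_iff_dvd]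
    push_cast at hp
    linear_combination hp
  obtain ⟨p', rfl⟩ := hp'
  refine ⟨p', q', by push_cast; ring, rfl, fun m b => ?_⟩
  have h1 := hΩ.fst_eq (m := m) (k := L) le_rfl (by omega) (s := u (4 * L * m + L) b)
    (t := u (4 * L * m + L + 1 + (4 * L : ℕ) * p') (b + q')) fun l => by
      have := hs.edge hΩ (hE (4 * L * m + L)) b l
      push_cast at this ⊢
      simpa only [four_mul_cast, zero_mul, add_zero] using this
  have h2 := hΩ.fst_eq (m := m + p') (k := L) le_rfl (by omega)
    (hs.edge_succ hΩ hy _ (b + q'))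
  rw [h1, h2, show 4 * L * m + L + 1 + (4 * L : ℕ) * p' = 4 * L * (m + p') + L + 1 by
    push_cast; ring]

end IsStack

end IsCode

/-- The pair of tiles coded in block `b` of column `c` when coding the tiling `τ`. -/
def columnTiles (L : ℕ) (τ : ℤ → ℤ → T) (c b : ℤ) : T × T :=
  (τ (c / (4 * L)) b,
    if 2 * L ≤ c % (4 * L) then τ (c / (4 * L)) b else τ (c / (4 * L) - 1) b)

lemma columnTiles_mul_add (τ : ℤ → ℤ → T) (m k b : ℤ) (h0 : 0 ≤ k) (hk : k < 4 * L) :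
    columnTiles L τ (4 * L * m + k) b = (τ m b, if 2 * L ≤ k then τ m b else τ (m - 1) b) := by
  have h1 : (4 * L * m + k) / (4 * L : ℤ) = m := by
    rw [Int.mul_add_ediv_left _ _ (by omega), Int.ediv_eq_zero_of_lt h0 hk, add_zero]
  have h2 : (4 * L * m + k) % (4 * L : ℤ) = k := by
    rw [Int.mul_add_emod_self_left, Int.emod_eq_of_lt h0 hk]
  rw [columnTiles, h1, h2]

lemma eq_of_cast_eq {k n : ℕ} (hk : k < 4 * L) (hn : n < 4 * L)
    (h : ((k : ℕ) : ZMod (4 * L)) = (n : ℕ)) : k = n :=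
  Nat.ModEq.eq_of_lt_of_lt ((ZMod.natCast_eq_natCast_iff _ _ _).1 h) hk hn

lemma exists_eq_mul_add (hL : 0 < L) (c : ℤ) :
    ∃ (m : ℤ) (k : ℕ), k < 4 * L ∧ c = 4 * L * m + k := by
  have h0 := Int.emod_nonneg c (b := 4 * L) (by omega)
  have h1 := Int.emod_lt_of_pos c (b := 4 * L) (by omega)
  have h2 := Int.mul_ediv_add_emod c (4 * L)
  exact ⟨c / (4 * L), (c % (4 * L)).toNat, by omega, by rw [Int.toNat_of_nonneg h0, h2]⟩

lemma IsCode.mem_XHV_of_tiling (hΩ : IsCode E L N Ω) {HM VM : T → T → Prop} {τ : ℤ → ℤ → T}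
    (hH : ∀ m b, HM (τ m b) (τ (m + 1) b)) (hV : ∀ m b, VM (τ m b) (τ m (b + 1))) :
    (fun v : ℤ × ℤ => Ω v.2 v.1 (columnTiles L τ v.1 (v.2 / N))) ∈
      XHV (vertexShift E) (codedColumns Ω N HM VM) := by
  have hN := hΩ.period_pos
  have hL := hΩ.length_pos
  refine ⟨fun l c => ?_, fun c l => ?_⟩
  · dsimp only
    push_cast
    obtain ⟨m, k, hk, rfl⟩ := exists_eq_mul_add hL c
    rcases (show k + 1 ≤ 4 * L from hk).eq_or_lt with hk1 | hk1
    · have e : (4 * L * m + k + 1 : ℤ) = 4 * L * (m + 1) + 0 := by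
        have : (k : ℤ) + 1 = 4 * L := by exact_mod_cast hk1
        linear_combination this
      rw [e, columnTiles_mul_add τ m k _ (by omega) (by omega),
        columnTiles_mul_add τ (m + 1) 0 _ (by omega) (by omega)]
      refine hΩ.edge _ _ _ _ (fun h => absurd ?_ h) fun _ => ?_
      · rw [cast_mul_add, Int.cast_natCast, ← Nat.cast_succ, Nat.succ_eq_add_one, hk1,
          ZMod.natCast_self]
      · dsimp only
        rw [if_pos (by omega), if_neg (by omega), add_sub_cancel_right]
    · rw [columnTiles_mul_add τ m k _ (by omega) (by omega), add_assoc (4 * (L : ℤ) * m),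
        columnTiles_mul_add τ m (k + 1) _ (by omega) (by omega)]
      refine hΩ.edge _ _ _ _ (fun _ => rfl) fun h => ?_
      have : k + 1 ≠ 2 * L := by
        intro h'
        apply h
        rw [cast_mul_add, Int.cast_natCast, ← Nat.cast_succ, Nat.succ_eq_add_one, h']
      dsimp only
      congr 1
      rw [eq_iff_iff]
      omega
  · refine ⟨l % N, c, fun n => columnTiles L τ c (l / N + n), Int.emod_nonneg _ (by omega),
      Int.emod_lt_of_pos _ (by omega), fun n _ _ => ?_, fun h => ?_, fun h => ?_⟩
    · have h1 := Int.mul_ediv_add_emod l N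
      dsimp only
      have h2 : l + n = n + l % N + N * (l / N) := by linarith
      rw [h2, hΩ.periodic_mul, Int.add_mul_ediv_left _ _ (by omega), add_comm (l / N : ℤ)]
    all_goals
      obtain ⟨m, k, hk, rfl⟩ := exists_eq_mul_add hL c
      rw [cast_mul_add, Int.cast_natCast] at h
      have := eq_of_cast_eq hk (by omega) h
      subst this
      dsimp only
      rw [columnTiles_mul_add _ _ _ _ (by omega) (by omega)]
    · rw [columnTiles_mul_add _ _ _ _ (by omega) (by omega)]
      dsimp only
      rw [if_neg (by omega), add_zero]
      exact ⟨by simpa using hH (m - 1) (l / N), hV _ _⟩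
    · dsimp only
      rw [if_pos (by omega)]

/-- If a graph does not satisfy condition D, then some choice of vertical constraints yields a
nonempty aperiodic combined subshift. -/
theorem exists_aperiodic_of_not_conditionD [Finite A] (h : ¬ ConditionD E) :
    ∃ V : Set (ℤ → A), IsSFT1 V ∧ (XHV (vertexShift E) V).Nonempty ∧
      ∀ x ∈ XHV (vertexShift E) V, ∀ v, shift2 v x = x → v = (0, 0) := by
  obtain ⟨L, hL⟩ := exists_separatingLength h
  obtain ⟨N, Ω, hΩ⟩ := hL.exists_isCode (T := MulTile)
  obtain ⟨τ, hH, hV⟩ := MulTile.exists_tiling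
  refine ⟨codedColumns Ω N MulTile.HMatch MulTile.VMatch, isSFT1_codedColumns _ _ _ _,
    ⟨_, hΩ.mem_XHV_of_tiling hH hV⟩, fun x hx v hv => ?_⟩
  obtain ⟨c₀, r₀, u, u', hs⟩ := hΩ.exists_isStack hx
  have hy (c l : ℤ) : E (x (c + c₀, l + r₀)) (x (c + 1 + c₀, l + r₀)) := by
    rw [add_right_comm]
    exact hx.1 (l + r₀) (c + c₀)
  have hper (c l : ℤ) : x (c + -v.1 + c₀, l + -v.2 + r₀) = x (c + c₀, l + r₀) := by
    rw [← congrFun hv (c + c₀, l + r₀), shift2]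
    congr 1
    ext <;> simp <;> ring
  obtain ⟨p, q, hp, hq, hτ⟩ := hs.exists_period hΩ hy hper
  obtain ⟨rfl, rfl⟩ := MulTile.aperiodic (τ := fun m b => (u (4 * L * m + L) b).1)
    (hs.hMatch hΩ hy) (hs.vMatch hΩ hy) p q hτ
  ext <;> simp_all

end Simulation

section PeriodicPoint

variable {A : Type*} {E : A → A → Prop}

lemma exists_eventually_eq {ι : Type*} [Finite A] (F : Ultrafilter ι) (f : ι → A) :
    ∃ a, ∀ᶠ k in F, f k = a := by
  obtain ⟨a, ha⟩ := (Ultrafilter.eventually_exists_iff (P := fun a k => f k = a)).1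
    (Eventually.of_forall fun k => ⟨f k, rfl⟩)
  exact ⟨a, ha⟩

lemma transGen_of_lt {y : ℤ → A} (hy : y ∈ vertexShift E) {i j : ℤ} (hij : i < j) :
    Relation.TransGen E (y i) (y j) := by
  induction j, (show i + 1 ≤ j from hij) using Int.leInduction with
  | base => exact .single (hy i)
  | succ j hj ih => exact (ih (by omega)).tail (hy j)

/-- A nonempty combined subshift contains a configuration each of whose rows stays in a single
strongly connected component. -/
lemma exists_recurrent_mem_XHV [Finite A] {V : Set (ℤ → A)} (hV : IsSFT1 V) {x : ℤ × ℤ → A}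
    (hx : x ∈ XHV (vertexShift E) V) :
    ∃ y ∈ XHV (vertexShift E) V, ∀ i i' j, Relation.TransGen E (y (i, j)) (y (i', j)) := by
  obtain ⟨F, rfl⟩ := hV
  obtain ⟨hrow, hcol⟩ := hx
  let U : Ultrafilter ℕ := hyperfilter ℕ
  have hU (n : ℕ) : ∀ᶠ k in U, n ≤ k :=
    (Nat.cofinite_eq_atTop ▸ hyperfilter_le_cofinite) (eventually_ge_atTop n)
  choose y hy using fun v : ℤ × ℤ => exists_eventually_eq U fun k : ℕ => x (v.1 + k, v.2)
  refine ⟨y, ⟨fun j i => ?_, fun i w hw ⟨l, hl⟩ => ?_⟩, fun i i' j => ?_⟩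
  · obtain ⟨k, h1, h2⟩ := ((hy (i, j)).and (hy (i + 1, j))).exists
    dsimp only at h1 h2 ⊢
    rw [← h1, ← h2, add_right_comm]
    exact hrow j (i + k)
  · have : ∀ᶠ k : ℕ in U, ∀ n : Fin w.length, x (i + k, l + (n : ℕ)) = y (i, l + (n : ℕ)) :=
      eventually_all.2 fun n => hy (i, l + (n : ℕ))
    obtain ⟨k, hk⟩ := this.exists
    exact hcol (i + k) w hw ⟨l, fun n hn => (hk ⟨n, hn⟩).trans (hl n hn)⟩
  · obtain ⟨k, hk⟩ := (hy (i, j)).exists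
    obtain ⟨k', hk', hlt⟩ := ((hy (i', j)).and (hU (i + k - i' + 1).toNat)).exists
    dsimp only at hk hk'
    rw [← hk, ← hk']
    exact transGen_of_lt (hrow j) (by omega)

/-- Under condition D, rows that stay in a single strongly connected component can all be closed
up with the same period. -/
lemma ConditionD.exists_period [Fintype A] (hD : ConditionD E) :
    ∃ P : ℕ, 0 < P ∧ ∀ y ∈ vertexShift E, (∀ i i', Relation.TransGen E (y i) (y i')) →
      E (y (P - 1)) (y 0) := by
  have hS {y : ℤ → A} (hyy : ∀ i i', Relation.TransGen E (y i) (y i')) :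
      IsSCC E {b | Relation.TransGen E (y 0) b ∧ Relation.TransGen E b (y 0)} ∧
      ∀ i, y i ∈ {b | Relation.TransGen E (y 0) b ∧ Relation.TransGen E b (y 0)} :=
    ⟨isSCC_of_transGen (hyy 0 0), fun i => ⟨hyy 0 i, hyy i 0⟩⟩
  rcases hD with h | h | h
  · refine ⟨1, one_pos, fun y _ hyy => ?_⟩
    simpa using h _ (hS hyy).1 _ ((hS hyy).2 0)
  · refine ⟨2, two_pos, fun y hy hyy => ?_⟩
    have h01 : E (y 0) (y 1) := hy 0
    norm_num
    by_cases he : y 0 = y 1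
    · rwa [← he] at h01 ⊢
    · exact h _ (hS hyy).1 _ ((hS hyy).2 0) _ ((hS hyy).2 1) he h01
  · have hp (a : A) : ∃ p : ℕ, 0 < p ∧ (Relation.TransGen E a a → ∃ f : A → ZMod p,
        ∀ v w, Relation.TransGen E a v → Relation.TransGen E v a → Relation.TransGen E a w →
          Relation.TransGen E w a → (E v w ↔ f w = f v + 1)) := by
      by_cases ha : Relation.TransGen E a a
      · obtain ⟨p, hp, f, -, hf⟩ := h _ (isSCC_of_transGen ha)
        exact ⟨p, hp, fun _ => ⟨f, fun v w h1 h2 h3 h4 => hf v ⟨h1, h2⟩ w ⟨h3, h4⟩⟩⟩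
      · exact ⟨1, one_pos, fun h => absurd h ha⟩
    choose p hp hf using hp
    refine ⟨∏ a, p a, Finset.prod_pos fun a _ => hp a, fun y hy hyy => ?_⟩
    obtain ⟨f, hf⟩ := hf (y 0) (hyy 0 0)
    have hstep (i : ℤ) : f (y i) = f (y 0) + i := by
      have hs (i : ℤ) : f (y (i + 1)) = f (y i) + 1 :=
        (hf _ _ (hyy _ _) (hyy _ _) (hyy _ _) (hyy _ _)).1 (hy i)
      induction i with
      | zero => simp
      | succ i ih => rw [hs, ih]; push_cast; ring
      | pred i ih =>
        have := hs (-i - 1)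
        rw [sub_add_cancel, ih] at this
        push_cast at this ⊢
        linear_combination -this
    rw [hf _ _ (hyy _ _) (hyy _ _) (hyy _ _) (hyy _ _), hstep (_ - 1)]
    have : ((∏ a, p a : ℕ) : ZMod (p (y 0))) = 0 :=
      (ZMod.natCast_eq_zero_iff _ _).2 (Finset.dvd_prod_of_mem p (Finset.mem_univ _))
    push_cast at this ⊢
    rw [this]
    ring

theorem ConditionD.exists_periodic [Fintype A] (hD : ConditionD E) {V : Set (ℤ → A)}
    (hV : IsSFT1 V) (hne : (XHV (vertexShift E) V).Nonempty) :
    ∃ x ∈ XHV (vertexShift E) V, ∃ v : ℤ × ℤ, v ≠ (0, 0) ∧ shift2 v x = x := by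
  obtain ⟨x, hx⟩ := hne
  obtain ⟨y, ⟨hrow, hcol⟩, hy⟩ := exists_recurrent_mem_XHV hV hx
  obtain ⟨P, hP, hclose⟩ := hD.exists_period
  refine ⟨fun v => y (v.1 % P, v.2), ⟨fun j i => ?_, fun i => hcol (i % P)⟩, (P, 0), ?_, ?_⟩
  · dsimp only
    have h0 := Int.emod_nonneg i (b := P) (by omega)
    have h1 := Int.emod_lt_of_pos i (b := P) (by omega)
    rw [← Int.emod_add_emod]
    by_cases h : i % P + 1 = P
    · rw [h, Int.emod_self, show i % P = P - 1 by omega]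
      exact hclose _ (hrow j) fun i i' => hy i i' j
    · rw [Int.emod_eq_of_lt (by omega : 0 ≤ i % P + 1) (by omega)]
      exact hrow j (i % P)
  · simp [hP.ne']
  · ext v
    simp [shift2]

end PeriodicPoint

/-- `X_{H,V}` is empty or contains a periodic configuration for every
one-dimensional SFT `V`, iff the Rauzy graph of `H` satisfies condition D. -/
theorem stmt11 {A : Type*} [Fintype A] (E : A → A → Prop)
    (hout : ∀ a, ∃ b, E a b) (hin : ∀ a, ∃ b, E b a) :
    (∀ V : Set (ℤ → A), IsSFT1 V →
        XHV (vertexShift E) V = ∅ ∨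
          ∃ x ∈ XHV (vertexShift E) V, ∃ v : ℤ × ℤ, v ≠ (0, 0) ∧ shift2 v x = x) ↔
      ConditionD E := by
  refine ⟨fun h => ?_, fun hD V hV => ?_⟩
  · by_contra hD
    obtain ⟨V, hV, hne, hap⟩ := exists_aperiodic_of_not_conditionD hD
    obtain h | ⟨x, hx, v, hv, hper⟩ := h V hV
    · exact hne.ne_empty h
    · exact hv (hap x hx v hper)
  · rcases (XHV (vertexShift E) V).eq_empty_or_nonempty with h | h
    · exact .inl h
    · exact .inr (hD.exists_periodic hV h)
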